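/- arXiv:1801.03109 — 6 statements merged into one kernel-verified Lean document; each statement's English description precedes it below -/
import Mathlib

section
/- Let (X, Σ) be a measurable space and let μ₁, μ₂, …, μₙ be finite nonatomic measures on (X, Σ). Then the set of points of ℝⁿ of the form (μ₁(E), μ₂(E), …, μₙ(E)), with E ranging over all measurable sets in Σ, is a closed convex subset of ℝⁿ. -/
open MeasureTheory

open Set Filter InnerProductSpace

section

variable {X : Type*} [MeasurableSpace X]

/-- Every measurable set of nonzero measure splits into two pieces of nonzero measure. -/
def IsNonatomic (ν : Measure X) : Prop :=
  ∀ E : Set X, MeasurableSet E → ν E ≠ 0 →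
    ∃ F ⊆ E, MeasurableSet F ∧ ν F ≠ 0 ∧ ν (E \ F) ≠ 0

theorem IsNonatomic.exists_pairwise_disjoint {ν : Measure X} (hν : IsNonatomic ν) (k : ℕ) :
    ∀ E : Set X, MeasurableSet E → ν E ≠ 0 →
      ∃ A : Fin k → Set X, (∀ j, MeasurableSet (A j)) ∧ (∀ j, A j ⊆ E) ∧ (∀ j, ν (A j) ≠ 0) ∧
        Pairwise (Function.onFun Disjoint A) := by
  induction k with
  | zero => exact fun E _ _ ↦ ⟨fun _ ↦ ∅, fun j ↦ j.elim0, fun j ↦ j.elim0, fun j ↦ j.elim0,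
      fun j ↦ j.elim0⟩
  | succ k ih =>
    intro E hE hE0
    obtain ⟨F, hFE, hF, hF0, hF1⟩ := hν E hE hE0
    obtain ⟨A, hA, hAE, hA0, hdisj⟩ := ih (E \ F) (hE.diff hF) hF1
    have hFA : ∀ j, Disjoint F (A j) := fun j ↦ disjoint_sdiff_right.mono_right (hAE j)
    refine ⟨Fin.cons F A, Fin.cases hF hA, Fin.cases hFE fun j ↦ (hAE j).trans sdiff_subset,
      Fin.cases hF0 hA0, ?_⟩
    intro i j hij
    induction i using Fin.cases with
    | zero =>
      induction j using Fin.cases with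
      | zero => exact absurd rfl hij
      | succ j => simpa [Function.onFun] using hFA j
    | succ i =>
      induction j using Fin.cases with
      | zero => simpa [Function.onFun] using (hFA i).symm
      | succ j => simpa [Function.onFun] using hdisj (fun h ↦ hij (congrArg Fin.succ h))

/-- The Riesz isomorphism into the dual with the weak-* topology. -/
noncomputable def toWeakDualL2 (ν : Measure X) : Lp ℝ 2 ν ≃ₗ[ℝ] WeakDual ℝ (Lp ℝ 2 ν) :=
  (toDual ℝ (Lp ℝ 2 ν)).toLinearEquiv.trans StrongDual.toWeakDual

theorem toWeakDualL2_apply {ν : Measure X} (g h : Lp ℝ 2 ν) : toWeakDualL2 ν g h = inner ℝ g h := rfl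

variable {ν : Measure X} [IsFiniteMeasure ν]

theorem IsNonatomic.exists_orthogonal {n : ℕ} (hν : IsNonatomic ν) (f : Fin n → Lp ℝ 2 ν)
    {E : Set X} (hE : MeasurableSet E) (hE0 : ν E ≠ 0) :
    ∃ h : Lp ℝ 2 ν, h ≠ 0 ∧ (∀ i, inner ℝ h (f i) = 0) ∧
      ∀ᵐ x ∂ν, |h x| ≤ E.indicator 1 x := by
  obtain ⟨A, hA, hAE, hA0, hdisj⟩ := hν.exists_pairwise_disjoint (n + 1) E hE hE0
  let u : Fin (n + 1) → Lp ℝ 2 ν := fun j ↦ indicatorConstLp 2 (hA j) (measure_ne_top ν _) (1 : ℝ)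
  have hu : ∀ j k, inner ℝ (u j) (u k) = ν.real (A j ∩ A k) := fun j k ↦
    L2.real_inner_indicatorConstLp_one_indicatorConstLp_one (hA j) (hA k)
  let L : (Fin (n + 1) → ℝ) →ₗ[ℝ] (Fin n → ℝ) :=
    LinearMap.pi fun i ↦ (innerₗ (Lp ℝ 2 ν) (f i)).comp (Fintype.linearCombination ℝ u)
  obtain ⟨c, hcL, hc⟩ := (Submodule.ne_bot_iff _).1 (L.ker_ne_bot_of_finrank_lt (by simp))
  obtain ⟨j, hj⟩ := Function.ne_iff.1 hc
  let C := ∑ k, |c k|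
  have hC : 0 < C := (abs_pos.2 hj).trans_le
    (Finset.single_le_sum (f := fun k ↦ |c k|) (fun _ _ ↦ abs_nonneg _) (Finset.mem_univ j))
  refine ⟨C⁻¹ • ∑ k, c k • u k, ?_, fun i ↦ ?_, ?_⟩
  · have hinner : inner ℝ (u j) (∑ k, c k • u k) = c j * ν.real (A j) := by
      rw [inner_sum, Finset.sum_eq_single j, real_inner_smul_right, hu, inter_self]
      · intro k _ hk
        rw [real_inner_smul_right, hu, (hdisj hk.symm).inter_eq, measureReal_empty, mul_zero]
      · simp
    refine smul_ne_zero (inv_ne_zero hC.ne') fun h ↦ ?_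
    rw [h, inner_zero_right, zero_eq_mul] at hinner
    exact hinner.elim hj ((measureReal_ne_zero_iff (measure_ne_top ν _)).2 (hA0 j))
  · have : inner ℝ (f i) (∑ k, c k • u k) = 0 := by
      simpa [L, Fintype.linearCombination_apply, inner_sum, real_inner_smul_right] using congrFun hcL i
    rw [inner_smul_left, real_inner_comm, this, mul_zero]
  · have h1 : ∀ᵐ x ∂ν, ∀ k, u k x = (A k).indicator (fun _ ↦ (1 : ℝ)) x :=
      ae_all_iff.2 fun k ↦ indicatorConstLp_coeFn
    have h2 : ∀ᵐ x ∂ν, ∀ k, (c k • u k : Lp ℝ 2 ν) x = c k • u k x :=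
      ae_all_iff.2 fun k ↦ Lp.coeFn_smul _ _
    filter_upwards [h1, h2, Lp.coeFn_smul C⁻¹ (∑ k, c k • u k),
      Lp.coeFn_finsetSum Finset.univ (fun k ↦ c k • u k)] with x h1 h2 h3 h4
    rw [h3, Pi.smul_apply, h4, smul_eq_mul, abs_mul, abs_of_pos (inv_pos.2 hC)]
    simp only [Finset.sum_apply, h2, h1]
    by_cases hx : x ∈ E
    · rw [indicator_of_mem hx, Pi.one_apply, inv_mul_le_one₀ hC]
      refine (Finset.abs_sum_le_sum_abs _ _).trans (Finset.sum_le_sum fun k _ ↦ ?_)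
      by_cases hk : x ∈ A k <;> simp [hk]
    · have : ∀ k, x ∉ A k := fun k hk ↦ hx (hAE k hk)
      simp [this, hx]

variable (ν) in
/-- Functionals on `L²` between `0` and integration, on indicators of measurable sets. They
correspond to the functions with values in `[0, 1]`. -/
def fractionalSets : Set (WeakDual ℝ (Lp ℝ 2 ν)) :=
  {φ | ∀ (A : Set X) (hA : MeasurableSet A),
    φ (indicatorConstLp 2 hA (measure_ne_top ν A) (1 : ℝ)) ∈ Icc 0 (ν.real A)}

theorem toWeakDualL2_mem_fractionalSets_iff {g : Lp ℝ 2 ν} :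
    toWeakDualL2 ν g ∈ fractionalSets ν ↔ ∀ᵐ x ∂ν, g x ∈ Icc 0 1 := by
  have key : ∀ A (hA : MeasurableSet A), toWeakDualL2 ν g
      (indicatorConstLp 2 hA (measure_ne_top ν A) (1 : ℝ)) = ∫ x in A, g x ∂ν := fun A hA ↦ by
    rw [toWeakDualL2_apply, real_inner_comm, L2.inner_indicatorConstLp_one]
  have hg : Integrable g ν := (Lp.memLp g).integrable one_le_two
  simp only [fractionalSets, mem_ofPred_eq, key]
  constructor
  · intro h
    have h0 : 0 ≤ᵐ[ν] g := ae_nonneg_of_forall_setIntegral_nonneg hg fun s hs _ ↦ (h s hs).1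
    have h1 : g ≤ᵐ[ν] fun _ ↦ (1 : ℝ) :=
      ae_le_of_forall_setIntegral_le hg (integrable_const 1) fun s hs _ ↦ by
        simpa using (h s hs).2
    filter_upwards [h0, h1] with x h0 h1 using ⟨h0, h1⟩
  · intro h A hA
    constructor
    · exact integral_nonneg_of_ae (ae_restrict_of_ae (h.mono fun x hx ↦ hx.1))
    · have := integral_mono_ae (μ := ν.restrict A) hg.integrableOn (integrable_const (1 : ℝ))
        (ae_restrict_of_ae (h.mono fun x hx ↦ hx.2))
      simpa using this

theorem convex_fractionalSets : Convex ℝ (fractionalSets ν) := by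
  intro φ hφ ψ hψ a b ha hb hab A hA
  exact convex_Icc (0 : ℝ) (ν.real A) (hφ A hA) (hψ A hA) ha hb hab

theorem isCompact_fractionalSets : IsCompact (fractionalSets ν) := by
  refine WeakDual.isCompact_of_bounded_of_closed ?_ ?_
  · refine (WeakDual.isBounded_closedBall (𝕜 := ℝ) (E := Lp ℝ 2 ν) 0
      (measureUnivNNReal ν ^ (2 : ENNReal).toReal⁻¹ * 1)).subset fun φ hφ ↦ ?_
    obtain ⟨g, rfl⟩ := (toWeakDualL2 ν).surjective φ
    rw [toWeakDualL2_mem_fractionalSets_iff] at hφ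
    rw [mem_preimage, mem_closedBall_zero_iff]
    refine ((toDual ℝ (Lp ℝ 2 ν)).norm_map g).trans_le (Lp.norm_le_of_ae_bound zero_le_one ?_)
    filter_upwards [hφ] with x hx
    rw [Real.norm_eq_abs, abs_of_nonneg hx.1]
    exact hx.2
  · simp only [fractionalSets, ofPred_forall]
    exact isClosed_iInter fun A ↦ isClosed_iInter fun hA ↦
      isClosed_Icc.preimage (WeakDual.eval_continuous _)

/-- An extreme point among the functions with values in `[0, 1]` with given inner products against
finitely many functions is an indicator function. -/
theorem IsNonatomic.ae_mem_pair_of_mem_extremePoints {n : ℕ} (hν : IsNonatomic ν)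
    (f : Fin n → Lp ℝ 2 ν) (p : Fin n → ℝ) {g : Lp ℝ 2 ν}
    (hg : toWeakDualL2 ν g ∈ (fractionalSets ν ∩ {φ | ∀ i, φ (f i) = p i}).extremePoints ℝ) :
    ∀ᵐ x ∂ν, g x = 0 ∨ g x = 1 := by
  have hg01 := toWeakDualL2_mem_fractionalSets_iff.1 hg.1.1
  have hnull : ∀ ε > 0, ν (g ⁻¹' Icc ε (1 - ε)) = 0 := by
    intro ε hε
    by_contra hE0
    obtain ⟨h, hh0, hhf, hhE⟩ := hν.exists_orthogonal f
      ((Lp.stronglyMeasurable g).measurable measurableSet_Icc) hE0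
    have hmem : ∀ t : ℝ, |t| = ε →
        toWeakDualL2 ν (g + t • h) ∈ fractionalSets ν ∩ {φ | ∀ i, φ (f i) = p i} := by
      intro t ht
      refine ⟨toWeakDualL2_mem_fractionalSets_iff.2 ?_, fun i ↦ ?_⟩
      · filter_upwards [hg01, hhE, Lp.coeFn_add g (t • h), Lp.coeFn_smul t h]
          with x hx hhx h1 h2
        rw [h1, Pi.add_apply, h2, Pi.smul_apply, smul_eq_mul]
        by_cases hxE : x ∈ g ⁻¹' Icc ε (1 - ε)
        · rw [indicator_of_mem hxE, Pi.one_apply] at hhx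
          have : |t * h x| ≤ ε := by
            rw [abs_mul, ht]
            exact mul_le_of_le_one_right hε.le hhx
          rw [abs_le] at this
          exact ⟨by linarith [hxE.1], by linarith [hxE.2]⟩
        · rw [indicator_of_notMem hxE, abs_nonpos_iff] at hhx
          simpa [hhx] using hx
      · have := hg.1.2 i
        rw [toWeakDualL2_apply] at this ⊢
        rw [inner_add_left, inner_smul_left, hhf, mul_zero, add_zero, this]
    have := hg.2 (hmem ε (abs_of_pos hε)) (hmem (-ε) (by rw [abs_neg, abs_of_pos hε]))
      ⟨1 / 2, 1 / 2, by norm_num, by norm_num, by norm_num, by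
        rw [← map_smul, ← map_smul, ← map_add]
        congr 1
        module⟩
    have := (toWeakDualL2 ν).injective this
    rw [add_eq_left] at this
    exact smul_ne_zero hε.ne' hh0 this
  have hall : ∀ᵐ x ∂ν, ∀ k : ℕ, x ∉ g ⁻¹' Icc (1 / ((k : ℝ) + 1)) (1 - 1 / ((k : ℝ) + 1)) :=
    ae_all_iff.2 fun k ↦ measure_eq_zero_iff_ae_notMem.1 (hnull _ Nat.one_div_pos_of_nat)
  filter_upwards [hg01, hall] with x hx hxk
  by_contra! hne
  have h0 : 0 < g x := lt_of_le_of_ne hx.1 hne.1.symm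
  have h1 : g x < 1 := lt_of_le_of_ne hx.2 hne.2
  obtain ⟨k, hk⟩ := exists_nat_one_div_lt (lt_min h0 (sub_pos.2 h1))
  rw [lt_min_iff] at hk
  exact hxk k ⟨hk.1.le, by linarith [hk.2]⟩

theorem IsNonatomic.image_fractionalSets {n : ℕ} (hν : IsNonatomic ν) (f : Fin n → Lp ℝ 2 ν) :
    (fun (φ : WeakDual ℝ (Lp ℝ 2 ν)) i ↦ φ (f i)) '' fractionalSets ν =
      {p | ∃ E : Set X, MeasurableSet E ∧ ∀ i, p i = ∫ x in E, f i x ∂ν} := by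
  have hind : ∀ E (hE : MeasurableSet E) i, toWeakDualL2 ν
      (indicatorConstLp 2 hE (measure_ne_top ν E) (1 : ℝ)) (f i) = ∫ x in E, f i x ∂ν :=
    fun E hE i ↦ by rw [toWeakDualL2_apply, L2.inner_indicatorConstLp_one]
  ext p
  constructor
  · rintro ⟨φ, hφ, rfl⟩
    have hclosed : IsClosed {ψ : WeakDual ℝ (Lp ℝ 2 ν) | ∀ i, ψ (f i) = φ (f i)} := by
      simp only [ofPred_forall]
      exact isClosed_iInter fun i ↦ isClosed_eq (WeakDual.eval_continuous _) continuous_const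
    have : LocallyConvexSpace ℝ (WeakDual ℝ (Lp ℝ 2 ν)) :=
      inferInstanceAs (LocallyConvexSpace ℝ (WeakBilin (topDualPairing ℝ (Lp ℝ 2 ν))))
    obtain ⟨ψ, hψ⟩ := (isCompact_fractionalSets.inter_right hclosed).extremePoints_nonempty
      ⟨φ, hφ, fun _ ↦ rfl⟩
    obtain ⟨g, rfl⟩ := (toWeakDualL2 ν).surjective ψ
    have hg := hν.ae_mem_pair_of_mem_extremePoints f _ hψ
    have hE : MeasurableSet (g ⁻¹' {1}) :=
      (Lp.stronglyMeasurable g).measurable (measurableSet_singleton 1)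
    have hgE : g = indicatorConstLp 2 hE (measure_ne_top ν _) (1 : ℝ) := by
      refine Lp.ext ?_
      filter_upwards [hg, indicatorConstLp_coeFn (p := 2) (hs := hE)
        (hμs := measure_ne_top ν _) (c := (1 : ℝ))] with x hx h1
      rw [h1]
      rcases hx with hx | hx <;> simp [indicator, hx]
    refine ⟨_, hE, fun i ↦ ?_⟩
    rw [← hind _ hE, ← hgE]
    exact (hψ.1.2 i).symm
  · rintro ⟨E, hE, hp⟩
    refine ⟨toWeakDualL2 ν (indicatorConstLp 2 hE (measure_ne_top ν E) (1 : ℝ)), ?_,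
      funext fun i ↦ (hind E hE i).trans (hp i).symm⟩
    rw [toWeakDualL2_mem_fractionalSets_iff]
    filter_upwards [indicatorConstLp_coeFn (p := 2) (hs := hE)
      (hμs := measure_ne_top ν _) (c := (1 : ℝ))] with x h1
    rw [h1]
    by_cases hx : x ∈ E <;> simp [hx]

theorem IsNonatomic.isClosed_and_convex_setOf_setIntegral {n : ℕ} (hν : IsNonatomic ν)
    (f : Fin n → Lp ℝ 2 ν) :
    IsClosed {p : Fin n → ℝ | ∃ E : Set X, MeasurableSet E ∧ ∀ i, p i = ∫ x in E, f i x ∂ν} ∧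
    Convex ℝ {p : Fin n → ℝ | ∃ E : Set X, MeasurableSet E ∧ ∀ i, p i = ∫ x in E, f i x ∂ν} := by
  rw [← hν.image_fractionalSets f]
  constructor
  · exact (isCompact_fractionalSets.image
      (continuous_pi fun i ↦ WeakDual.eval_continuous (f i))).isClosed
  · exact convex_fractionalSets.is_linear_image
      ⟨fun _ _ ↦ rfl, fun _ _ ↦ rfl⟩

theorem exists_Lp_two_setIntegral_eq {μ : Measure X} (h : μ ≤ ν) :
    ∃ f : Lp ℝ 2 ν, ∀ E : Set X, ∫ x in E, f x ∂ν = (μ E).toReal := by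
  have : IsFiniteMeasure μ := isFiniteMeasure_of_le ν h
  have hmem : MemLp (fun x ↦ (μ.rnDeriv ν x).toReal) 2 ν := by
    refine MemLp.of_bound (Measure.measurable_rnDeriv _ _).ennreal_toReal.aestronglyMeasurable 1 ?_
    filter_upwards [Measure.rnDeriv_le_one_of_le h] with x hx
    rw [Real.norm_eq_abs, abs_of_nonneg ENNReal.toReal_nonneg]
    exact ENNReal.toReal_mono ENNReal.one_ne_top hx
  refine ⟨hmem.toLp _, fun E ↦ ?_⟩
  rw [integral_congr_ae (ae_restrict_of_ae hmem.coeFn_toLp),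
    Measure.setIntegral_toReal_rnDeriv (Measure.absolutelyContinuous_of_le h)]
  rfl

end

/-- **Lyapunov's convexity theorem.** If `μ 0, …, μ (n-1)` are finite nonatomic
measures on a measurable space `X`, then the set of points of `ℝⁿ` of the form
`(μ 0 E, …, μ (n-1) E)`, with `E` ranging over the measurable sets, is closed and convex. -/
theorem lyapunov_convexity
    {X : Type*} [MeasurableSpace X] {n : ℕ} (μ : Fin n → Measure X)
    (hfin : ∀ i, IsFiniteMeasure (μ i))
    (hnonatomic : ∀ i, ∀ E : Set X, MeasurableSet E → μ i E ≠ 0 →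
      ∃ F ⊆ E, MeasurableSet F ∧ μ i F ≠ 0 ∧ μ i F ≠ μ i E) :
    IsClosed {p : Fin n → ℝ | ∃ E : Set X, MeasurableSet E ∧
        ∀ i, p i = (μ i E).toReal} ∧
    Convex ℝ {p : Fin n → ℝ | ∃ E : Set X, MeasurableSet E ∧
        ∀ i, p i = (μ i E).toReal} := by
  have hle : ∀ i, μ i ≤ ∑ j, μ j := fun i ↦
    Finset.single_le_sum (f := μ) (fun _ _ ↦ Measure.zero_le _) (Finset.mem_univ i)
  have hν : IsNonatomic (∑ j, μ j) := by
    intro E hE hE0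
    obtain ⟨i, hi⟩ : ∃ i, μ i E ≠ 0 := by
      by_contra! h
      exact hE0 (by simp [h])
    obtain ⟨F, hFE, hF, hF0, hF1⟩ := hnonatomic i E hE hi
    refine ⟨F, hFE, hF, fun h ↦ hF0 (le_antisymm ((hle i F).trans_eq h) zero_le), fun h ↦ hF1 ?_⟩
    have h0 : μ i (E \ F) = 0 := le_antisymm ((hle i _).trans_eq h) zero_le
    rw [← measure_inter_add_sdiff E hF, h0, add_zero, inter_eq_self_of_subset_right hFE]
  choose f hf using fun i ↦ exists_Lp_two_setIntegral_eq (hle i)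
  simpa only [hf] using hν.isClosed_and_convex_setOf_setIntegral f
end

section
/- Let X be a measurable space, let H be a finite-dimensional complex inner product space, and let ν be a positive operator-valued measure on X with values in B(H) which is nonatomic. Then the range R_ν = {ν(E) : E measurable} is a closed convex subset of B(H) (closedness in the operator norm, which in finite dimensions coincides with the weak*-topology on bounded sets). -/
open MeasureTheory
open scoped ComplexInnerProductSpace ComplexOrder

namespace MeasureTheory

open Set

section Nonatomic

variable {X : Type*} [MeasurableSpace X] {μ : Measure X}

/-- If every set of positive measure splits into two pieces of positive measure, then it contains
a sequence of pairwise disjoint sets of positive measure. -/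
theorem exists_seq_pairwise_disjoint_measure_ne_zero
    (hμ : ∀ E, MeasurableSet E → μ E ≠ 0 →
      ∃ F ⊆ E, MeasurableSet F ∧ μ F ≠ 0 ∧ μ (E \ F) ≠ 0)
    {A : Set X} (hA : MeasurableSet A) (hA0 : μ A ≠ 0) :
    ∃ B : ℕ → Set X, (∀ n, MeasurableSet (B n)) ∧ (∀ n, B n ⊆ A) ∧ (∀ n, μ (B n) ≠ 0) ∧
      Pairwise (Function.onFun Disjoint B) := by
  choose! f hfsub hfm hf0 hfdiff using hμ
  have hC : ∀ n, MeasurableSet (f^[n] A) ∧ μ (f^[n] A) ≠ 0 := by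
    intro n
    induction n with
    | zero => exact ⟨hA, hA0⟩
    | succ n ih =>
      rw [Function.iterate_succ_apply']
      exact ⟨hfm _ ih.1 ih.2, hf0 _ ih.1 ih.2⟩
  have hanti : Antitone fun n ↦ f^[n] A := antitone_nat_of_succ_le fun n ↦ by
    rw [Function.iterate_succ_apply']
    exact hfsub _ (hC n).1 (hC n).2
  refine ⟨fun n ↦ f^[n] A \ f^[n + 1] A, fun n ↦ (hC n).1.diff (hC (n + 1)).1,
    fun n ↦ sdiff_subset.trans (hanti (Nat.zero_le n)), fun n ↦ ?_, ?_⟩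
  · simp only [Function.iterate_succ_apply']
    exact hfdiff _ (hC n).1 (hC n).2
  · refine (pairwise_disjoint_on _).2 fun m n hmn ↦ ?_
    rw [Set.disjoint_left]
    exact fun x hx hx' ↦ hx.2 (hanti (Nat.succ_le_of_lt hmn) hx'.1)

end Nonatomic

section DualUnitInterval

variable {X : Type*} [MeasurableSpace X] (μ : Measure X)

/-- The functionals on `L²` represented by a function with values in `[0, 1]`. -/
def dualUnitInterval : Set (WeakDual ℝ (Lp ℝ 2 μ)) :=
  {φ | ∃ g : Lp ℝ 2 μ, (∀ᵐ x ∂μ, 0 ≤ g x ∧ g x ≤ 1) ∧ ∀ f, φ f = inner ℝ g f}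

theorem convex_dualUnitInterval : Convex ℝ (dualUnitInterval μ) := by
  rintro φ ⟨g, hg, hφ⟩ ψ ⟨k, hk, hψ⟩ a b ha hb hab
  refine ⟨a • g + b • k, ?_, fun f ↦ ?_⟩
  · filter_upwards [hg, hk, Lp.coeFn_add (a • g) (b • k), Lp.coeFn_smul a g, Lp.coeFn_smul b k]
      with x h1 h2 h3 h4 h5
    rw [h3, Pi.add_apply, h4, h5]
    exact convex_Icc (0 : ℝ) 1 h1 h2 ha hb hab
  · rw [inner_add_left, real_inner_smul_left, real_inner_smul_left, ← hφ, ← hψ]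
    rfl

variable [IsFiniteMeasure μ]

theorem isCompact_dualUnitInterval : IsCompact (dualUnitInterval μ) := by
  let e (E : Set X) (hE : MeasurableSet E) : Lp ℝ 2 μ :=
    indicatorConstLp 2 hE (measure_ne_top μ E) 1
  have heq : dualUnitInterval μ =
      (WeakDual.toStrongDual ⁻¹' Metric.closedBall 0 ‖e univ MeasurableSet.univ‖) ∩
        {φ | ∀ E hE, φ (e E hE) ∈ Icc 0 (μ.real E)} := by
    ext φ
    constructor
    · rintro ⟨g, hg, hφ⟩
      refine ⟨?_, fun E hE ↦ ?_⟩
      · rw [mem_preimage, mem_closedBall_zero_iff]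
        have hn : ‖g‖ ≤ ‖e univ MeasurableSet.univ‖ := by
          refine Lp.norm_le_norm_of_ae_le ?_
          filter_upwards [hg, indicatorConstLp_coeFn (p := 2) (hs := MeasurableSet.univ)
            (hμs := measure_ne_top μ univ) (c := (1 : ℝ))] with x hx hx'
          rw [hx', Real.norm_of_nonneg hx.1]
          simpa using hx.2
        refine ContinuousLinearMap.opNorm_le_bound _ (norm_nonneg _) fun f ↦ ?_
        calc ‖φ f‖ = ‖inner ℝ g f‖ := by rw [hφ]
          _ ≤ ‖g‖ * ‖f‖ := norm_inner_le_norm _ _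
          _ ≤ _ := by gcongr
      · have hgi : Integrable g μ := (Lp.memLp g).integrable one_le_two
        rw [hφ, real_inner_comm, L2.inner_indicatorConstLp_one]
        refine ⟨integral_nonneg_of_ae (ae_restrict_of_ae (hg.mono fun x hx ↦ hx.1)), ?_⟩
        calc ∫ x in E, g x ∂μ ≤ ∫ x in E, (1 : ℝ) ∂μ :=
              integral_mono_ae hgi.integrableOn (integrable_const _)
                (ae_restrict_of_ae (hg.mono fun x hx ↦ hx.2))
          _ = μ.real E := by simp
    · rintro ⟨-, hφ⟩
      let g : Lp ℝ 2 μ := (InnerProductSpace.toDual ℝ _).symm (WeakDual.toStrongDual φ)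
      have hg : ∀ f, φ f = inner ℝ g f := fun f ↦
        (InnerProductSpace.toDual_symm_apply (y := WeakDual.toStrongDual φ)).symm
      have hgi : Integrable g μ := (Lp.memLp g).integrable one_le_two
      have hφ' : ∀ E, MeasurableSet E → ∫ x in E, g x ∂μ ∈ Icc 0 (μ.real E) := by
        intro E hE
        rw [← L2.inner_indicatorConstLp_one hE (measure_ne_top μ E) g, real_inner_comm, ← hg]
        exact hφ E hE
      refine ⟨g, ?_, hg⟩
      filter_upwards [ae_nonneg_of_forall_setIntegral_nonneg hgi fun s hs _ ↦ (hφ' s hs).1,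
        ae_le_of_forall_setIntegral_le hgi (integrable_const 1)
          fun s hs _ ↦ by simpa using (hφ' s hs).2] with x h1 h2 using ⟨h1, h2⟩
  rw [heq]
  refine (WeakDual.isCompact_closedBall _ _).inter_right ?_
  simp only [ofPred_forall]
  exact isClosed_iInter fun E ↦ isClosed_iInter fun hE ↦
    isClosed_Icc.preimage (WeakDual.eval_continuous _)

variable {μ}

/-- An extreme point of a set cut out of `dualUnitInterval μ` by conditions that factor through a
finite-dimensional set function is represented by a function with values in `{0, 1}`. -/
theorem eq_zero_or_eq_one_of_mem_extremePoints
    (hμ : ∀ E, MeasurableSet E → μ E ≠ 0 →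
      ∃ F ⊆ E, MeasurableSet F ∧ μ F ≠ 0 ∧ μ (E \ F) ≠ 0)
    {V : Type*} [AddCommGroup V] [Module ℝ V] [FiniteDimensional ℝ V] (m : Set X → V)
    {ι : Type*} (ℓ : ι → V →ₗ[ℝ] ℝ) (h : ι → Lp ℝ 2 μ)
    (hm : ∀ i E, MeasurableSet E → ∫ x in E, h i x ∂μ = ℓ i (m E)) (a : ι → ℝ)
    {φ : WeakDual ℝ (Lp ℝ 2 μ)}
    (hφ : φ ∈ (dualUnitInterval μ ∩ {ψ | ∀ i, ψ (h i) = a i}).extremePoints ℝ)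
    {g : Lp ℝ 2 μ} (hg : ∀ᵐ x ∂μ, 0 ≤ g x ∧ g x ≤ 1) (hφg : ∀ f, φ f = inner ℝ g f) :
    ∀ᵐ x ∂μ, g x = 0 ∨ g x = 1 := by
  have hgm : Measurable g := (Lp.stronglyMeasurable g).measurable
  have key : ∀ δ : ℝ, 0 < δ → μ (g ⁻¹' Icc δ (1 - δ)) = 0 := by
    intro δ hδ
    by_contra hA0
    obtain ⟨B, hBm, hBsub, hB0, hBd⟩ := exists_seq_pairwise_disjoint_measure_ne_zero hμ
      (hgm measurableSet_Icc) hA0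
    let n := Module.finrank ℝ V + 1
    let L : (Fin n → ℝ) →ₗ[ℝ] V := Fintype.linearCombination ℝ fun j : Fin n ↦ m (B j)
    have hL : L.ker ≠ ⊥ := LinearMap.ker_ne_bot_of_finrank_lt (by simp [n])
    obtain ⟨c, hc, hc0⟩ := Submodule.exists_mem_ne_zero_of_ne_bot hL
    obtain ⟨k, hk⟩ := Function.ne_iff.1 hc0
    rw [LinearMap.mem_ker, Fintype.linearCombination_apply] at hc
    let e (j : Fin n) : Lp ℝ 2 μ := indicatorConstLp 2 (hBm j) (measure_ne_top μ (B j)) 1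
    let t : ℝ := δ / (1 + ∑ j, |c j|)
    have hS : 0 < 1 + ∑ j, |c j| := by positivity
    have ht : 0 < t := div_pos hδ hS
    let u : Lp ℝ 2 μ := ∑ j, (t * c j) • e j
    have hu : ∀ᵐ x ∂μ, u x = ∑ j, (t * c j) * (B j).indicator 1 x := by
      have h1 : ∀ᵐ x ∂μ, ∀ j, ((t * c j) • e j : Lp ℝ 2 μ) x = (t * c j) * (B j).indicator 1 x := by
        refine ae_all_iff.2 fun j ↦ ?_
        filter_upwards [Lp.coeFn_smul (t * c j) (e j), indicatorConstLp_coeFn (p := 2)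
          (hs := hBm j) (hμs := measure_ne_top μ (B j)) (c := (1 : ℝ))] with x h1 h2
        rw [h1, Pi.smul_apply, h2]
        rfl
      filter_upwards [h1, Lp.coeFn_finsetSum (s := Finset.univ) (f := fun j ↦ (t * c j) • e j)]
        with x h1 h2
      simp only [u]
      rw [h2]
      simp [h1]
    have hu0 : u ≠ 0 := by
      intro hu0
      have h1 : inner ℝ (e k) u = t * c k * μ.real (B k) := by
        simp only [u, inner_sum, real_inner_smul_right]
        rw [Finset.sum_eq_single k]
        · simp only [e]
          rw [L2.real_inner_indicatorConstLp_one_indicatorConstLp_one, inter_self]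
        · intro j _ hj
          simp only [e]
          rw [L2.real_inner_indicatorConstLp_one_indicatorConstLp_one,
            (hBd (fun h ↦ hj (Fin.ext h).symm) : Disjoint (B k) (B j)).inter_eq]
          simp
        · simp
      rw [hu0, inner_zero_right] at h1
      have : μ.real (B k) ≠ 0 := by simp [measureReal_def, ENNReal.toReal_eq_zero_iff, hB0]
      have := mul_ne_zero (mul_ne_zero ht.ne' hk) this
      exact this h1.symm
    have huh : ∀ i, inner ℝ u (h i) = 0 := by
      intro i
      simp only [u, sum_inner, real_inner_smul_left, e, L2.inner_indicatorConstLp_one]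
      calc ∑ j, t * c j * ∫ x in B j, h i x ∂μ = t * ℓ i (∑ j, c j • m (B j)) := by
            simp [hm i _ (hBm _), Finset.mul_sum, mul_assoc]
        _ = 0 := by rw [hc, map_zero, mul_zero]
    have hug : ∀ᵐ x ∂μ, |u x| ≤ g x ∧ |u x| ≤ 1 - g x := by
      filter_upwards [hu, hg] with x hux hgx
      by_cases hx : x ∈ g ⁻¹' Icc δ (1 - δ)
      · have : |u x| ≤ δ := by
          rw [hux]
          calc |∑ j, t * c j * (B j).indicator 1 x| ≤ ∑ j, t * |c j| := by
                refine (Finset.abs_sum_le_sum_abs _ _).trans (Finset.sum_le_sum fun j _ ↦ ?_)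
                rw [abs_mul, abs_mul, abs_of_pos ht]
                refine mul_le_of_le_one_right (by positivity) ?_
                by_cases hj : x ∈ B j <;> simp [hj]
            _ = δ * ((∑ j, |c j|) / (1 + ∑ j, |c j|)) := by
                rw [← Finset.mul_sum]; simp only [t]; ring
            _ ≤ δ := mul_le_of_le_one_right hδ.le ((div_le_one hS).2 (by linarith))
        exact ⟨this.trans hx.1, this.trans (by linarith [hx.2])⟩
      · have : u x = 0 := by
          rw [hux]
          refine Finset.sum_eq_zero fun j _ ↦ ?_
          rw [indicator_of_notMem fun hj ↦ hx (hBsub j hj), mul_zero]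
        rw [this, abs_zero]
        exact ⟨hgx.1, by linarith [hgx.2]⟩
    let w : WeakDual ℝ (Lp ℝ 2 μ) := StrongDual.toWeakDual (innerSL ℝ u)
    have hw : ∀ f, w f = inner ℝ u f := fun f ↦ rfl
    have hmem1 : φ + w ∈ dualUnitInterval μ ∩ {ψ | ∀ i, ψ (h i) = a i} := by
      refine ⟨⟨g + u, ?_, fun f ↦ ?_⟩, fun i ↦ ?_⟩
      · filter_upwards [hug, Lp.coeFn_add g u] with x h1 h2
        rw [h2, Pi.add_apply]
        constructor <;> linarith [neg_abs_le (u x), le_abs_self (u x)]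
      · rw [inner_add_left, ← hφg, ← hw]; rfl
      · change φ (h i) + w (h i) = a i
        rw [hw, huh, add_zero, hφ.1.2 i]
    have hmem2 : φ - w ∈ dualUnitInterval μ ∩ {ψ | ∀ i, ψ (h i) = a i} := by
      refine ⟨⟨g - u, ?_, fun f ↦ ?_⟩, fun i ↦ ?_⟩
      · filter_upwards [hug, Lp.coeFn_sub g u] with x h1 h2
        rw [h2, Pi.sub_apply]
        constructor <;> linarith [neg_abs_le (u x), le_abs_self (u x)]
      · rw [inner_sub_left, ← hφg, ← hw]; rfl
      · change φ (h i) - w (h i) = a i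
        rw [hw, huh, sub_zero, hφ.1.2 i]
    have hφw : φ + w = φ := ((mem_extremePoints.1 hφ).2 _ hmem1 _ hmem2
      ⟨1 / 2, 1 / 2, by norm_num, by norm_num, by norm_num, by module⟩).1
    have hw0 : w = 0 := by simpa using hφw
    have : inner ℝ u u = 0 := by rw [← hw, hw0]; rfl
    exact hu0 (inner_self_eq_zero.1 this)
  have hall : ∀ᵐ x ∂μ, ∀ n : ℕ, x ∉ g ⁻¹' Icc (1 / ((n : ℝ) + 1)) (1 - 1 / ((n : ℝ) + 1)) :=
    ae_all_iff.2 fun n ↦ measure_eq_zero_iff_ae_notMem.1 (key _ (by positivity))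
  filter_upwards [hg, hall] with x hx hx'
  by_contra! hne
  obtain ⟨n, hn⟩ := exists_nat_one_div_lt
    (lt_min (lt_of_le_of_ne hx.1 hne.1.symm) (sub_pos.2 (lt_of_le_of_ne hx.2 hne.2)))
  exact hx' n ⟨(hn.trans_le (min_le_left _ _)).le, by linarith [hn.trans_le (min_le_right _ _)]⟩

/-- **Lyapunov's convexity theorem** for a set function with values in a finite-dimensional space,
seen through a family of functionals with square-integrable densities. -/
theorem isCompact_and_convex_setOf_setIntegral
    (hμ : ∀ E, MeasurableSet E → μ E ≠ 0 →
      ∃ F ⊆ E, MeasurableSet F ∧ μ F ≠ 0 ∧ μ (E \ F) ≠ 0)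
    {V : Type*} [AddCommGroup V] [Module ℝ V] [FiniteDimensional ℝ V] (m : Set X → V)
    {ι : Type*} (ℓ : ι → V →ₗ[ℝ] ℝ) (h : ι → Lp ℝ 2 μ)
    (hm : ∀ i E, MeasurableSet E → ∫ x in E, h i x ∂μ = ℓ i (m E)) :
    IsCompact {a : ι → ℝ | ∃ E, MeasurableSet E ∧ ∀ i, ℓ i (m E) = a i} ∧
      Convex ℝ {a : ι → ℝ | ∃ E, MeasurableSet E ∧ ∀ i, ℓ i (m E) = a i} := by
  let Φ : WeakDual ℝ (Lp ℝ 2 μ) →ₗ[ℝ] ι → ℝ :=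
    { toFun := fun φ i ↦ φ (h i)
      map_add' := fun _ _ ↦ rfl
      map_smul' := fun _ _ ↦ rfl }
  have hΦ : Continuous Φ := continuous_pi fun i ↦ WeakDual.eval_continuous (h i)
  have hlc : LocallyConvexSpace ℝ (WeakDual ℝ (Lp ℝ 2 μ)) :=
    inferInstanceAs (LocallyConvexSpace ℝ (WeakBilin (topDualPairing ℝ (Lp ℝ 2 μ))))
  have heq : {a : ι → ℝ | ∃ E, MeasurableSet E ∧ ∀ i, ℓ i (m E) = a i} =
      Φ '' dualUnitInterval μ := by
    ext a
    constructor
    · rintro ⟨E, hE, ha⟩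
      let e : Lp ℝ 2 μ := indicatorConstLp 2 hE (measure_ne_top μ E) 1
      refine ⟨StrongDual.toWeakDual (innerSL ℝ e), ⟨e, ?_, fun f ↦ rfl⟩, funext fun i ↦ ?_⟩
      · filter_upwards [indicatorConstLp_coeFn (p := 2) (hs := hE)
          (hμs := measure_ne_top μ E) (c := (1 : ℝ))] with x hx
        rw [hx]
        by_cases hxE : x ∈ E <;> simp [hxE]
      · change inner ℝ e (h i) = a i
        rw [L2.inner_indicatorConstLp_one, hm i E hE, ha]
    · rintro ⟨ψ, hψ, rfl⟩
      have hK : IsCompact (dualUnitInterval μ ∩ {φ | ∀ i, φ (h i) = Φ ψ i}) := by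
        refine (isCompact_dualUnitInterval μ).inter_right ?_
        simp only [ofPred_forall]
        exact isClosed_iInter fun i ↦
          isClosed_eq (WeakDual.eval_continuous _) continuous_const
      obtain ⟨φ, hφ⟩ := hK.extremePoints_nonempty ⟨ψ, hψ, fun i ↦ rfl⟩
      obtain ⟨g, hg, hφg⟩ := hφ.1.1
      have h01 := eq_zero_or_eq_one_of_mem_extremePoints hμ m ℓ h hm _ hφ hg hφg
      have hE : MeasurableSet (g ⁻¹' {1}) :=
        (Lp.stronglyMeasurable g).measurable (measurableSet_singleton 1)
      have hge : g = indicatorConstLp 2 hE (measure_ne_top μ _) 1 := by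
        refine Lp.ext ?_
        filter_upwards [h01, indicatorConstLp_coeFn (p := 2) (hs := hE)
          (hμs := measure_ne_top μ _) (c := (1 : ℝ))] with x hx hx'
        rw [hx']
        rcases hx with hx | hx <;> simp [indicator, hx]
      refine ⟨_, hE, fun i ↦ ?_⟩
      rw [← hm i _ hE, ← L2.inner_indicatorConstLp_one hE (measure_ne_top μ _), ← hge, ← hφg]
      exact hφ.1.2 i
  rw [heq]
  exact ⟨(isCompact_dualUnitInterval μ).image hΦ, (convex_dualUnitInterval μ).linear_image Φ⟩

end DualUnitInterval

/-- A measure dominated by a multiple of a finite measure has a square-integrable density. -/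
theorem exists_Lp_two_setIntegral_eq {X : Type*} [MeasurableSpace X] {μ ρ : Measure X}
    [IsFiniteMeasure μ] [IsFiniteMeasure ρ] {C : NNReal}
    (hρ : ∀ E, MeasurableSet E → ρ E ≤ C * μ E) :
    ∃ h : Lp ℝ 2 μ, ∀ E, MeasurableSet E → ∫ x in E, h x ∂μ = ρ.real E := by
  have hac : ρ ≪ μ := Measure.AbsolutelyContinuous.mk fun E hE h0 ↦ by
    simpa [h0] using hρ E hE
  have hle : ρ.rnDeriv μ ≤ᵐ[μ] fun _ ↦ (C : ENNReal) := by
    refine ae_le_of_forall_setLIntegral_le_of_sigmaFinite (Measure.measurable_rnDeriv _ _)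
      fun s hs _ ↦ ?_
    rw [Measure.setLIntegral_rnDeriv hac, setLIntegral_const]
    exact hρ s hs
  have hmem : MemLp (fun x ↦ (ρ.rnDeriv μ x).toReal) 2 μ := by
    refine MemLp.of_bound (Measure.measurable_rnDeriv _ _).ennreal_toReal.aestronglyMeasurable
      (C : ℝ) (hle.mono fun x hx ↦ ?_)
    rw [Real.norm_of_nonneg ENNReal.toReal_nonneg]
    exact ENNReal.toReal_mono ENNReal.coe_ne_top hx
  refine ⟨hmem.toLp, fun E hE ↦ ?_⟩
  rw [integral_congr_ae (ae_restrict_of_ae hmem.coeFn_toLp), Measure.setIntegral_toReal_rnDeriv hac]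


section POVM

variable {X : Type*} [MeasurableSpace X] {H : Type*} [NormedAddCommGroup H] [InnerProductSpace ℂ H]

/-- The quadratic form of an operator at a vector, as a real-linear functional of the operator. -/
noncomputable def reInnerMapSelf (x : H) : (H →L[ℂ] H) →ₗ[ℝ] ℝ where
  toFun T := (⟪T x, x⟫).re
  map_add' S T := by simp
  map_smul' r T := by
    simp [← Complex.coe_smul, -Complex.real_smul, mul_comm]

theorem continuous_reInnerMapSelf (x : H) : Continuous (reInnerMapSelf x) := by
  change Continuous fun T : H →L[ℂ] H ↦ (⟪T x, x⟫).re
  fun_prop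

/-- The scalar measures `E ↦ ⟪ν E x, x⟫` of a positive operator-valued measure `ν`. -/
theorem exists_measure_real_eq_reInnerMapSelf (ν : VectorMeasure X (H →L[ℂ] H))
    (hpos : ∀ E : Set X, MeasurableSet E → ∀ x : H, 0 ≤ ⟪(ν E) x, x⟫) (x : H) :
    ∃ ρ : Measure X, IsFiniteMeasure ρ ∧
      ∀ E, MeasurableSet E → ρ.real E = reInnerMapSelf x (ν E) := by
  let s : SignedMeasure X :=
    ν.mapRange (reInnerMapSelf x).toAddMonoidHom (continuous_reInnerMapSelf x)
  have hs : 0 ≤[Set.univ] s := by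
    refine VectorMeasure.restrict_le_restrict_of_subset_le _ _ fun E hE _ ↦ ?_
    exact (Complex.nonneg_iff.1 (hpos E hE x)).1
  refine ⟨s.toMeasureOfZeroLE _ MeasurableSet.univ hs, inferInstance, fun E hE ↦ ?_⟩
  rw [SignedMeasure.toMeasureOfZeroLE_real_apply _ _ _ hE, Set.univ_inter]
  rfl

theorem reInnerMapSelf_add_le {T : H →L[ℂ] H} (hT : ∀ x, 0 ≤ ⟪T x, x⟫) (x y : H) :
    reInnerMapSelf (x + y) T ≤ 2 * (reInnerMapSelf x T + reInnerMapSelf y T) := by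
  have h := (Complex.nonneg_iff.1 (hT (x - y))).1
  simp only [map_sub, inner_sub_left, inner_sub_right, Complex.sub_re] at h
  simp only [reInnerMapSelf, LinearMap.coe_mk, AddHom.coe_mk, map_add, inner_add_left,
    inner_add_right, Complex.add_re]
  linarith

theorem reInnerMapSelf_smul (T : H →L[ℂ] H) (c : ℂ) (x : H) :
    reInnerMapSelf (c • x) T = ‖c‖ ^ 2 * reInnerMapSelf x T := by
  simp only [reInnerMapSelf, LinearMap.coe_mk, AddHom.coe_mk, map_smul, inner_smul_left,
    inner_smul_right, ← mul_assoc, Complex.mul_conj']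
  rw [← Complex.ofReal_pow, Complex.re_ofReal_mul]

/-- The quadratic forms of positive operators are dominated by their values on a spanning family. -/
theorem exists_forall_reInnerMapSelf_le {ι : Type*} [Fintype ι] {b : ι → H}
    (hb : Submodule.span ℂ (Set.range b) = ⊤) (x : H) :
    ∃ C : NNReal, ∀ T : H →L[ℂ] H, (∀ x, 0 ≤ ⟪T x, x⟫) →
      reInnerMapSelf x T ≤ C * ∑ i, reInnerMapSelf (b i) T := by
  have hx : x ∈ Submodule.span ℂ (Set.range b) := hb ▸ Submodule.mem_top
  induction hx using Submodule.span_induction with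
  | mem x hx =>
    obtain ⟨i, rfl⟩ := hx
    refine ⟨1, fun T hT ↦ ?_⟩
    rw [NNReal.coe_one, one_mul]
    exact Finset.single_le_sum (f := fun i ↦ reInnerMapSelf (b i) T)
      (fun j _ ↦ (Complex.nonneg_iff.1 (hT (b j))).1) (Finset.mem_univ i)
  | zero => exact ⟨0, fun T hT ↦ by simp [reInnerMapSelf]⟩
  | add x y _ _ hx hy =>
    obtain ⟨C, hC⟩ := hx
    obtain ⟨D, hD⟩ := hy
    refine ⟨2 * (C + D), fun T hT ↦ (reInnerMapSelf_add_le hT x y).trans ?_⟩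
    push_cast
    linarith [hC T hT, hD T hT]
  | smul c x _ hx =>
    obtain ⟨C, hC⟩ := hx
    refine ⟨‖c‖₊ ^ 2 * C, fun T hT ↦ ?_⟩
    rw [reInnerMapSelf_smul]
    push_cast
    rw [mul_assoc]
    exact mul_le_mul_of_nonneg_left (hC T hT) (by positivity)

theorem eq_of_reInnerMapSelf_eq {S T : H →L[ℂ] H} (hS : ∀ x, (⟪S x, x⟫).im = 0)
    (hT : ∀ x, (⟪T x, x⟫).im = 0) (h : ∀ x, reInnerMapSelf x S = reInnerMapSelf x T) : S = T :=
  ContinuousLinearMap.coe_injective <| (ext_inner_map _ _).1 fun x ↦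
    Complex.ext (h x) ((hS x).trans (hT x).symm)

end POVM

end MeasureTheory

/-- **Operator-valued Lyapunov theorem (finite dimensions).** The range of a
nonatomic positive operator-valued measure with values in the bounded operators
on a finite-dimensional complex Hilbert space is a closed convex set. -/
theorem povm_range_closed_convex
    {X : Type*} [MeasurableSpace X]
    {H : Type*} [NormedAddCommGroup H] [InnerProductSpace ℂ H]
    [FiniteDimensional ℂ H]
    (ν : VectorMeasure X (H →L[ℂ] H))
    (hpos : ∀ E : Set X, MeasurableSet E → ∀ x : H, 0 ≤ ⟪(ν E) x, x⟫)
    (hnonatomic : ∀ E : Set X, MeasurableSet E → ν E ≠ 0 →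
      ∃ F ⊆ E, MeasurableSet F ∧ ν F ≠ 0 ∧ ν F ≠ ν E) :
    IsClosed {T : H →L[ℂ] H | ∃ E : Set X, MeasurableSet E ∧ ν E = T} ∧
    Convex ℝ {T : H →L[ℂ] H | ∃ E : Set X, MeasurableSet E ∧ ν E = T} := by
  have hpos' : ∀ E, MeasurableSet E → ∀ x, 0 ≤ reInnerMapSelf x (ν E) := fun E hE x ↦
    (Complex.nonneg_iff.1 (hpos E hE x)).1
  have him : ∀ E, MeasurableSet E → ∀ x, (⟪ν E x, x⟫).im = 0 := fun E hE x ↦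
    (Complex.nonneg_iff.1 (hpos E hE x)).2.symm
  choose ρ hρfin hρ using exists_measure_real_eq_reInnerMapSelf ν hpos
  let b := Module.finBasis ℂ H
  let μ : Measure X := ∑ i, ρ (b i)
  have hμfin : IsFiniteMeasure μ := inferInstance
  have hμ : ∀ E, MeasurableSet E → μ.real E = ∑ i, reInnerMapSelf (b i) (ν E) := by
    intro E hE
    simp only [μ, measureReal_def, Measure.coe_finsetSum, Finset.sum_apply]
    rw [ENNReal.toReal_sum fun i _ ↦ measure_ne_top _ _]
    exact Finset.sum_congr rfl fun i _ ↦ hρ (b i) E hE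
  have hdom : ∀ x, ∃ C : NNReal, ∀ E, MeasurableSet E → ρ x E ≤ C * μ E := by
    intro x
    obtain ⟨C, hC⟩ := exists_forall_reInnerMapSelf_le b.span_eq x
    refine ⟨C, fun E hE ↦ ?_⟩
    rw [← ENNReal.toReal_le_toReal (measure_ne_top _ _)
      (ENNReal.mul_ne_top ENNReal.coe_ne_top (measure_ne_top _ _)), ENNReal.toReal_mul]
    change (ρ x).real E ≤ C * μ.real E
    rw [hρ x E hE, hμ E hE]
    exact hC _ (hpos E hE)
  have hμν : ∀ E, MeasurableSet E → (μ E = 0 ↔ ν E = 0) := by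
    intro E hE
    constructor
    · intro h0
      refine eq_of_reInnerMapSelf_eq (him E hE) (by simp) fun x ↦ ?_
      obtain ⟨C, hC⟩ := hdom x
      have : ρ x E = 0 := by simpa [h0] using hC E hE
      rw [← hρ x E hE, measureReal_def, this, map_zero, ENNReal.toReal_zero]
    · intro h0
      rw [← measureReal_eq_zero_iff, hμ E hE]
      simp [h0]
  have hsplit : ∀ E, MeasurableSet E → μ E ≠ 0 →
      ∃ F ⊆ E, MeasurableSet F ∧ μ F ≠ 0 ∧ μ (E \ F) ≠ 0 := by
    intro E hE hE0
    obtain ⟨F, hFE, hF, hF0, hFne⟩ := hnonatomic E hE fun h ↦ hE0 ((hμν E hE).2 h)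
    refine ⟨F, hFE, hF, fun h ↦ hF0 ((hμν F hF).1 h), fun h ↦ hFne ?_⟩
    have hadd := VectorMeasure.of_add_of_sdiff (v := ν) hF hE hFE
    rwa [(hμν _ (hE.diff hF)).1 h, add_zero] at hadd
  choose C hC using hdom
  choose h hh using fun x ↦ exists_Lp_two_setIntegral_eq (hC x)
  have hfd : FiniteDimensional ℝ (H →L[ℂ] H) := FiniteDimensional.complexToReal _
  obtain ⟨hcompact, hconvex⟩ := isCompact_and_convex_setOf_setIntegral hsplit ν reInnerMapSelf h
    fun x E hE ↦ by rw [hh x E hE, hρ x E hE]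
  let Ψ : (H →L[ℂ] H) →ₗ[ℝ] H → ℝ := LinearMap.pi reInnerMapSelf
  have hΨ : Continuous Ψ := continuous_pi continuous_reInnerMapSelf
  have heq : {T : H →L[ℂ] H | ∃ E : Set X, MeasurableSet E ∧ ν E = T} =
      Ψ ⁻¹' {a | ∃ E, MeasurableSet E ∧ ∀ x, reInnerMapSelf x (ν E) = a x} ∩
        {T | ∀ x, (⟪T x, x⟫).im = 0} := by
    ext T
    constructor
    · rintro ⟨E, hE, rfl⟩
      exact ⟨⟨E, hE, fun _ ↦ rfl⟩, him E hE⟩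
    · rintro ⟨⟨E, hE, hT⟩, hTim⟩
      exact ⟨E, hE, eq_of_reInnerMapSelf_eq (him E hE) hTim hT⟩
  rw [heq]
  constructor
  · refine (hcompact.isClosed.preimage hΨ).inter ?_
    simp only [Set.ofPred_forall]
    exact isClosed_iInter fun x ↦ isClosed_eq (by fun_prop) continuous_const
  · refine (hconvex.linear_preimage Ψ).inter ?_
    intro S hS T hT s t _ _ _ x
    simp [← Complex.coe_smul, hS x, hT x, -Complex.real_smul]
end

section
/- Let X be a measurable space, let H₁, …, Hₙ be finite-dimensional complex inner product spaces, and for i = 1, …, n let νᵢ be a nonatomic positive operator-valued measure on X with values in B(Hᵢ). Then the set of points of B(H₁) × ⋯ × B(Hₙ) of the form (ν₁(E), ν₂(E), …, νₙ(E)), with E ranging over all measurable subsets of X, is a closed convex subset of the product space. -/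
open MeasureTheory
open scoped ComplexInnerProductSpace ComplexOrder

theorem exists_disjoint_family_of_nonatomic {X : Type*} [MeasurableSpace X] {μ : Measure X}
    (hμ : ∀ E, MeasurableSet E → μ E ≠ 0 →
      ∃ F ⊆ E, MeasurableSet F ∧ μ F ≠ 0 ∧ μ (E \ F) ≠ 0) (n : ℕ) :
    ∀ E : Set X, MeasurableSet E → μ E ≠ 0 → ∃ A : Fin n → Set X,
      (∀ i, MeasurableSet (A i)) ∧ (∀ i, A i ⊆ E) ∧ (∀ i, μ (A i) ≠ 0) ∧
      Pairwise (Function.onFun Disjoint A) := by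
  induction n with
  | zero => exact fun E _ _ ↦ ⟨fun _ ↦ ∅, nofun, nofun, nofun, nofun⟩
  | succ n ih =>
    intro E hE hE0
    obtain ⟨F, hFE, hF, hF0, hEF0⟩ := hμ E hE hE0
    obtain ⟨A, hA, hAF, hA0, hAd⟩ := ih F hF hF0
    refine ⟨Fin.cons (E \ F) A, Fin.cases (hE.diff hF) hA,
      Fin.cases Set.sdiff_subset fun i ↦ (hAF i).trans hFE, Fin.cases hEF0 hA0, ?_⟩
    have hd (i) : Disjoint (E \ F) (A i) := Set.disjoint_sdiff_left.mono_right (hAF i)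
    refine Fin.cases (Fin.cases (fun h ↦ (h rfl).elim) fun j _ ↦ hd j) fun i ↦
      Fin.cases (fun _ ↦ (hd i).symm) fun j hij ↦ hAd fun h ↦ hij (congrArg _ h)

theorem Lp_mem_Icc_iff_setIntegral {X : Type*} [MeasurableSpace X] {μ : Measure X}
    [IsFiniteMeasure μ] (g : Lp ℝ 2 μ) :
    (∀ᵐ x ∂μ, g x ∈ Set.Icc (0 : ℝ) 1) ↔
      ∀ E, MeasurableSet E → ∫ x in E, g x ∂μ ∈ Set.Icc 0 (μ.real E) := by
  have hg : Integrable g μ := (Lp.memLp g).integrable (by norm_num)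
  constructor
  · intro h E hE
    refine ⟨integral_nonneg_of_ae (ae_restrict_of_ae (h.mono fun _ hx ↦ hx.1)), ?_⟩
    calc ∫ x in E, g x ∂μ ≤ ∫ _ in E, (1 : ℝ) ∂μ :=
          integral_mono_ae hg.integrableOn (integrable_const _)
            (ae_restrict_of_ae (h.mono fun _ hx ↦ hx.2))
      _ = μ.real E := by simp
  · intro h
    have h0 := ae_nonneg_of_forall_setIntegral_nonneg hg fun E hE _ ↦ (h E hE).1
    have h1 : g ≤ᵐ[μ] fun _ ↦ (1 : ℝ) :=
      ae_le_of_forall_setIntegral_le hg (integrable_const _) fun E hE _ ↦ by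
        simpa using (h E hE).2
    filter_upwards [h0, h1] with x hx0 hx1 using ⟨hx0, hx1⟩

/-- The elements of `L²(μ)` with values in `[0, 1]`, seen as functionals on `L²(μ)`. -/
def unitIntervalFunctionals {X : Type*} [MeasurableSpace X] (μ : Measure X) :
    Set (WeakDual ℝ (Lp ℝ 2 μ)) :=
  {ξ | ∀ᵐ x ∂μ, (InnerProductSpace.toDual ℝ (Lp ℝ 2 μ)).symm (WeakDual.toStrongDual ξ) x ∈
    Set.Icc (0 : ℝ) 1}

theorem isCompact_unitIntervalFunctionals {X : Type*} [MeasurableSpace X] (μ : Measure X)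
    [IsFiniteMeasure μ] : IsCompact (unitIntervalFunctionals μ) := by
  refine WeakDual.isCompact_of_bounded_of_closed ?_ ?_
  · rw [← WeakDual.isBounded_toWeakDual_preimage_iff_isBounded]
    refine (Metric.isBounded_closedBall (x := 0)
      (r := (measureUnivNNReal μ : ℝ) ^ (2 : ENNReal).toReal⁻¹ * 1)).subset fun ξ hξ ↦ ?_
    rw [mem_closedBall_zero_iff, ← (InnerProductSpace.toDual ℝ (Lp ℝ 2 μ)).symm.norm_map]
    refine Lp.norm_le_of_ae_bound zero_le_one ?_
    have hξ' : StrongDual.toWeakDual ξ ∈ unitIntervalFunctionals μ := hξ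
    filter_upwards [hξ'] with x hx
    exact (Real.norm_of_nonneg hx.1).trans_le hx.2
  · have : unitIntervalFunctionals μ = ⋂ (E : Set X) (hE : MeasurableSet E),
        (fun ξ ↦ ξ (indicatorConstLp 2 hE (measure_ne_top μ E) 1)) ⁻¹' Set.Icc 0 (μ.real E) := by
      ext ξ
      simp only [unitIntervalFunctionals, Set.mem_ofPred_eq, Set.mem_iInter,
        Lp_mem_Icc_iff_setIntegral]
      refine forall₂_congr fun E hE ↦ ?_
      rw [← L2.inner_indicatorConstLp_one hE (measure_ne_top μ E), real_inner_comm,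
        InnerProductSpace.toDual_symm_apply]
      rfl
    rw [this]
    exact isClosed_iInter fun E ↦ isClosed_iInter fun hE ↦ isClosed_Icc.preimage (WeakDual.eval_continuous _)

instance WeakDual.instLocallyConvexSpaceReal {E : Type*} [NormedAddCommGroup E]
    [NormedSpace ℝ E] : LocallyConvexSpace ℝ (WeakDual ℝ E) :=
  inferInstanceAs (LocallyConvexSpace ℝ (WeakBilin (topDualPairing ℝ E)))

/-- Over a nonatomic measure, a `[0, 1]`-valued function that is not an indicator can be perturbed
in both directions inside the kernel of any linear map to a finite-dimensional space. -/
theorem exists_perturbation_of_nonatomic {X V : Type*} [MeasurableSpace X] {μ : Measure X}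
    [IsFiniteMeasure μ] [AddCommGroup V] [Module ℝ V] [FiniteDimensional ℝ V]
    (hμ : ∀ E, MeasurableSet E → μ E ≠ 0 →
      ∃ F ⊆ E, MeasurableSet F ∧ μ F ≠ 0 ∧ μ (E \ F) ≠ 0)
    (φ : Lp ℝ 2 μ →ₗ[ℝ] V) (g : Lp ℝ 2 μ) (hg : ∀ᵐ x ∂μ, g x ∈ Set.Icc (0 : ℝ) 1)
    (hg' : ¬ ∀ᵐ x ∂μ, g x = 0 ∨ g x = 1) :
    ∃ h : Lp ℝ 2 μ, h ≠ 0 ∧ φ h = 0 ∧ (∀ᵐ x ∂μ, (g + h) x ∈ Set.Icc (0 : ℝ) 1) ∧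
      ∀ᵐ x ∂μ, (g - h) x ∈ Set.Icc (0 : ℝ) 1 := by
  have hgm : Measurable g := (Lp.stronglyMeasurable g).measurable
  obtain ⟨ε, hε, hZ⟩ : ∃ ε > 0, μ {x | g x ∈ Set.Icc ε (1 - ε)} ≠ 0 := by
    by_contra! H
    refine hg' ?_
    have H' : ∀ᵐ x ∂μ, ∀ n : ℕ, g x ∉ Set.Icc (1 / ((n : ℝ) + 1)) (1 - 1 / ((n : ℝ) + 1)) :=
      ae_all_iff.2 fun n ↦ measure_eq_zero_iff_ae_notMem.1 (H _ Nat.one_div_pos_of_nat)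
    filter_upwards [hg, H'] with x hx hx'
    by_contra! hne
    obtain ⟨n, hn⟩ := exists_nat_one_div_lt
      (lt_min (lt_of_le_of_ne hx.1 hne.1.symm) (sub_pos.2 (lt_of_le_of_ne hx.2 hne.2)))
    rw [lt_min_iff] at hn
    exact hx' n ⟨hn.1.le, by linarith [hn.2]⟩
  set d := Module.finrank ℝ V + 1
  obtain ⟨A, hA, hAZ, hA0, hAd⟩ := exists_disjoint_family_of_nonatomic hμ d _
    (hgm measurableSet_Icc) hZ
  let u (i : Fin d) : Lp ℝ 2 μ := indicatorConstLp 2 (hA i) (measure_ne_top μ _) 1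
  have hu : ∀ᵐ x ∂μ, ∀ i, u i x = (A i).indicator (fun _ ↦ (1 : ℝ)) x :=
    ae_all_iff.2 fun i ↦ indicatorConstLp_coeFn
  let ψ : (Fin d → ℝ) →ₗ[ℝ] Lp ℝ 2 μ := Fintype.linearCombination ℝ u
  have hψ (c : Fin d → ℝ) : ∀ᵐ x ∂μ, (∀ i, x ∈ A i → ψ c x = c i) ∧
      ((∀ i, x ∉ A i) → ψ c x = 0) := by
    have h1 : ψ c =ᵐ[μ] fun x ↦ ∑ i, c i * u i x := by
      simp only [ψ, Fintype.linearCombination_apply]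
      refine (Lp.coeFn_finsetSum _ _).trans ?_
      have h2 : ∀ᵐ x ∂μ, ∀ i, (c i • u i : Lp ℝ 2 μ) x = c i * u i x :=
        ae_all_iff.2 fun i ↦ Lp.coeFn_smul _ _
      filter_upwards [h2] with x hx
      simp [hx]
    filter_upwards [h1, hu] with x hx hux
    rw [hx]
    simp only [hux]
    refine ⟨fun i hi ↦ ?_, fun h ↦ Finset.sum_eq_zero fun i _ ↦ by simp [h i]⟩
    rw [Finset.sum_eq_single i]
    · simp [hi]
    · intro j _ hj
      simp [Set.disjoint_right.1 (hAd hj) hi]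
    · simp
  obtain ⟨c, hc, hc0, hb⟩ : ∃ c, φ (ψ c) = 0 ∧ c ≠ 0 ∧ ∀ i, |c i| ≤ ε := by
    obtain ⟨c, hc, hc0⟩ := Submodule.exists_mem_ne_zero_of_ne_bot
      (LinearMap.ker_ne_bot_of_finrank_lt (f := φ ∘ₗ ψ) (by simp [d]))
    have hcn : 0 < ‖c‖ := norm_pos_iff.2 hc0
    refine ⟨(ε / ‖c‖) • c, ?_, smul_ne_zero (div_pos hε hcn).ne' hc0, fun i ↦ ?_⟩
    · rw [map_smul, map_smul, show φ (ψ c) = 0 from hc, smul_zero]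
    · rw [Pi.smul_apply, smul_eq_mul, abs_mul, abs_of_pos (div_pos hε hcn), div_mul_eq_mul_div,
        div_le_iff₀ hcn]
      exact mul_le_mul_of_nonneg_left (norm_le_pi_norm c i) hε.le
  have hbd : ∀ᵐ x ∂μ, ψ c x = 0 ∨
      |ψ c x| ≤ ε ∧ g x ∈ Set.Icc ε (1 - ε) := by
    filter_upwards [hψ c] with x hx
    by_cases h : ∃ i, x ∈ A i
    · obtain ⟨i, hi⟩ := h
      exact .inr ⟨hx.1 i hi ▸ hb i, hAZ i hi⟩
    · exact .inl (hx.2 (not_exists.1 h))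
  refine ⟨ψ c, fun h0 ↦ ?_, hc, ?_, ?_⟩
  · obtain ⟨i, hi⟩ := Function.ne_iff.1 hc0
    refine hA0 i (measure_eq_zero_iff_ae_notMem.2 ?_)
    have hz : ψ c =ᵐ[μ] 0 := h0 ▸ Lp.coeFn_zero _ _ _
    filter_upwards [hψ c, hz] with x hx hx0 hxi
    have := hx.1 i hxi
    rw [hx0] at this
    exact hi this.symm
  · filter_upwards [hbd, hg, Lp.coeFn_add g (ψ c)] with x hx hgx hadd
    rw [hadd, Pi.add_apply]
    rcases hx with hx | ⟨hx, hgx'⟩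
    · simpa [hx] using hgx
    · rw [abs_le] at hx
      exact ⟨by linarith [hx.1, hgx'.1], by linarith [hx.2, hgx'.2]⟩
  · filter_upwards [hbd, hg, Lp.coeFn_sub g (ψ c)] with x hx hgx hadd
    rw [hadd, Pi.sub_apply]
    rcases hx with hx | ⟨hx, hgx'⟩
    · simpa [hx] using hgx
    · rw [abs_le] at hx
      exact ⟨by linarith [hx.2, hgx'.1], by linarith [hx.1, hgx'.2]⟩

/-- Finitely many moments of a `[0, 1]`-valued function are also the moments of an indicator:
an extreme point of the set of functions with these moments is one. -/
theorem exists_indicator_of_mem_unitIntervalFunctionals {X ι : Type*} [MeasurableSpace X]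
    {μ : Measure X} [IsFiniteMeasure μ] [Finite ι]
    (hμ : ∀ E, MeasurableSet E → μ E ≠ 0 →
      ∃ F ⊆ E, MeasurableSet F ∧ μ F ≠ 0 ∧ μ (E \ F) ≠ 0)
    (f : ι → Lp ℝ 2 μ) {ξ : WeakDual ℝ (Lp ℝ 2 μ)} (hξ : ξ ∈ unitIntervalFunctionals μ) :
    ∃ E, MeasurableSet E ∧ ∀ k, ξ (f k) = ∫ x in E, f k x ∂μ := by
  have := Fintype.ofFinite ι
  let D := InnerProductSpace.toDual ℝ (Lp ℝ 2 μ)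
  obtain ⟨η, hη⟩ : (Set.extremePoints ℝ
      (unitIntervalFunctionals μ ∩ {η | ∀ k, η (f k) = ξ (f k)})).Nonempty := by
    refine ((isCompact_unitIntervalFunctionals μ).inter_right ?_).extremePoints_nonempty
      ⟨ξ, hξ, fun _ ↦ rfl⟩
    rw [Set.ofPred_forall]
    exact isClosed_iInter fun k ↦ isClosed_eq (WeakDual.eval_continuous _) continuous_const
  rw [mem_extremePoints] at hη
  obtain ⟨⟨hη, hηξ⟩, hext⟩ := hη
  let g : Lp ℝ 2 μ := D.symm (WeakDual.toStrongDual η)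
  have hgη : StrongDual.toWeakDual (D g) = η := by simp [g]
  let φ : Lp ℝ 2 μ →ₗ[ℝ] ι → ℝ := LinearMap.pi fun k ↦ (innerSL ℝ (f k)).toLinearMap
  have hg01 : ∀ᵐ x ∂μ, g x = 0 ∨ g x = 1 := by
    by_contra hne
    obtain ⟨h, h0, hφ, hadd, hsub⟩ := exists_perturbation_of_nonatomic hμ φ g hη hne
    have key (h : Lp ℝ 2 μ) (hφ : φ h = 0) (hh : ∀ᵐ x ∂μ, (g + h) x ∈ Set.Icc (0 : ℝ) 1) :
        StrongDual.toWeakDual (D (g + h)) ∈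
          unitIntervalFunctionals μ ∩ {η | ∀ k, η (f k) = ξ (f k)} := by
      refine ⟨?_, fun k ↦ ?_⟩
      · have : D.symm (WeakDual.toStrongDual (StrongDual.toWeakDual (D (g + h)))) = g + h :=
          D.symm_apply_apply _
        change ∀ᵐ x ∂μ, D.symm _ x ∈ _
        rwa [this]
      · have hk : inner ℝ h (f k) = 0 := (real_inner_comm _ _).trans (congrFun hφ k)
        rw [← hηξ k, ← hgη]
        change inner ℝ (g + h) (f k) = inner ℝ g (f k)
        rw [inner_add_left, hk, add_zero]
    have h1 := key h hφ hadd
    have h2 := key (-h) (by rw [map_neg, hφ, neg_zero]) (by rwa [← sub_eq_add_neg])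
    have hseg : η ∈ openSegment ℝ (StrongDual.toWeakDual (D (g + h)))
        (StrongDual.toWeakDual (D (g + -h))) := by
      refine ⟨1 / 2, 1 / 2, by norm_num, by norm_num, by norm_num, ?_⟩
      rw [← smul_add, ← map_add, ← map_add, ← hgη, ← map_smul]
      congr 1
      rw [show g + h + (g + -h) = (2 : ℝ) • g by rw [two_smul]; abel, D.map_smulₛₗ, smul_smul]
      norm_num
    have := (hext _ h1 _ h2 hseg).1
    rw [← hgη] at this
    have := D.injective (StrongDual.toWeakDual.injective this)
    exact h0 (by simpa using this)
  have hE : MeasurableSet {x | g x = 1} :=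
    (Lp.stronglyMeasurable g).measurable (measurableSet_singleton 1)
  refine ⟨{x | g x = 1}, hE, fun k ↦ ?_⟩
  have hgE : g = indicatorConstLp 2 hE (measure_ne_top μ _) 1 := by
    refine Lp.ext ?_
    filter_upwards [hg01, indicatorConstLp_coeFn (p := 2) (hs := hE)
      (hμs := measure_ne_top μ _) (c := (1 : ℝ))] with x hx hx'
    rw [hx']
    rcases hx with hx | hx <;> simp [hx]
  rw [← hηξ k, ← hgη, ← L2.inner_indicatorConstLp_one hE (measure_ne_top μ _), ← hgE]
  rfl

theorem indicator_mem_unitIntervalFunctionals {X : Type*} [MeasurableSpace X]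
    {μ : Measure X} [IsFiniteMeasure μ] {E : Set X} (hE : MeasurableSet E) :
    StrongDual.toWeakDual (InnerProductSpace.toDual ℝ (Lp ℝ 2 μ)
      (indicatorConstLp 2 hE (measure_ne_top μ E) 1)) ∈ unitIntervalFunctionals μ := by
  change ∀ᵐ x ∂μ, (InnerProductSpace.toDual ℝ (Lp ℝ 2 μ)).symm (InnerProductSpace.toDual ℝ
    (Lp ℝ 2 μ) (indicatorConstLp 2 hE (measure_ne_top μ E) 1)) x ∈ _
  rw [LinearIsometryEquiv.symm_apply_apply]
  filter_upwards [indicatorConstLp_coeFn (p := 2) (hs := hE)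
    (hμs := measure_ne_top μ _) (c := (1 : ℝ))] with x hx
  rw [hx]
  by_cases h : x ∈ E <;> simp [h]

theorem convex_unitIntervalFunctionals {X : Type*} [MeasurableSpace X] (μ : Measure X) :
    Convex ℝ (unitIntervalFunctionals μ) := by
  intro ξ hξ η hη a b ha hb hab
  let D := InnerProductSpace.toDual ℝ (Lp ℝ 2 μ)
  have hD : D.symm (WeakDual.toStrongDual (a • ξ + b • η)) =
      a • D.symm (WeakDual.toStrongDual ξ) + b • D.symm (WeakDual.toStrongDual η) := by
    simp
  change ∀ᵐ x ∂μ, D.symm (WeakDual.toStrongDual (a • ξ + b • η)) x ∈ _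
  rw [hD]
  filter_upwards [hξ, hη, Lp.coeFn_add (a • D.symm (WeakDual.toStrongDual ξ))
    (b • D.symm (WeakDual.toStrongDual η)), Lp.coeFn_smul a (D.symm (WeakDual.toStrongDual ξ)),
    Lp.coeFn_smul b (D.symm (WeakDual.toStrongDual η))] with x hx hy h1 h2 h3
  rw [h1, Pi.add_apply, h2, h3]
  exact convex_Icc (0 : ℝ) 1 hx hy ha hb hab

/-- **Lyapunov's convexity theorem**: the range of a finite family of measures dominated by a
finite nonatomic measure is closed and convex. -/
theorem isClosed_convex_range_of_le_nonatomic {X ι : Type*} [MeasurableSpace X] [Finite ι]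
    {μ : Measure X} [IsFiniteMeasure μ]
    (hμ : ∀ E, MeasurableSet E → μ E ≠ 0 →
      ∃ F ⊆ E, MeasurableSet F ∧ μ F ≠ 0 ∧ μ (E \ F) ≠ 0)
    (m : ι → Measure X) (hm : ∀ k, m k ≤ μ) :
    IsClosed {p : ι → ℝ | ∃ E, MeasurableSet E ∧ ∀ k, p k = (m k).real E} ∧
    Convex ℝ {p : ι → ℝ | ∃ E, MeasurableSet E ∧ ∀ k, p k = (m k).real E} := by
  have hfin (k) : IsFiniteMeasure (m k) := isFiniteMeasure_of_le μ (hm k)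
  have hL (k) : MemLp (fun x ↦ ((m k).rnDeriv μ x).toReal) 2 μ := by
    refine MemLp.of_bound (Measure.measurable_rnDeriv _ _).ennreal_toReal.aestronglyMeasurable 1 ?_
    filter_upwards [Measure.rnDeriv_le_one_of_le (hm k)] with x hx
    rw [Real.norm_of_nonneg ENNReal.toReal_nonneg]
    exact ENNReal.toReal_le_of_le_ofReal zero_le_one (by simpa using hx)
  let f (k) : Lp ℝ 2 μ := (hL k).toLp
  have hf (k) (E : Set X) : ∫ x in E, f k x ∂μ = (m k).real E := by
    rw [integral_congr_ae (ae_restrict_of_ae (hL k).coeFn_toLp)]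
    exact Measure.setIntegral_toReal_rnDeriv (Measure.absolutelyContinuous_of_le (hm k)) E
  let Φ : WeakDual ℝ (Lp ℝ 2 μ) →ₗ[ℝ] ι → ℝ :=
    { toFun := fun ξ k ↦ ξ (f k)
      map_add' := fun _ _ ↦ rfl
      map_smul' := fun _ _ ↦ rfl }
  have hΦ : Continuous Φ := continuous_pi fun k ↦ WeakDual.eval_continuous (f k)
  have himg : {p : ι → ℝ | ∃ E, MeasurableSet E ∧ ∀ k, p k = (m k).real E} =
      Φ '' unitIntervalFunctionals μ := by
    ext p
    constructor
    · rintro ⟨E, hE, hp⟩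
      refine ⟨_, indicator_mem_unitIntervalFunctionals hE, funext fun k ↦ ?_⟩
      rw [hp k, ← hf k E, ← L2.inner_indicatorConstLp_one hE (measure_ne_top μ E)]
      rfl
    · rintro ⟨ξ, hξ, rfl⟩
      obtain ⟨E, hE, h⟩ := exists_indicator_of_mem_unitIntervalFunctionals hμ f hξ
      exact ⟨E, hE, fun k ↦ (h k).trans (hf k E)⟩
  rw [himg]
  exact ⟨((isCompact_unitIntervalFunctionals μ).image hΦ).isClosed,
    (convex_unitIntervalFunctionals μ).linear_image Φ⟩

theorem SignedMeasure.isClosed_convex_range_of_nonatomic {X ι : Type*} [MeasurableSpace X]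
    [Finite ι] (s : ι → SignedMeasure X) (hs : ∀ k E, MeasurableSet E → 0 ≤ s k E)
    (hna : ∀ E, MeasurableSet E → (∃ k, s k E ≠ 0) →
      ∃ F ⊆ E, MeasurableSet F ∧ (∃ k, s k F ≠ 0) ∧ ∃ k, s k (E \ F) ≠ 0) :
    IsClosed {p : ι → ℝ | ∃ E, MeasurableSet E ∧ ∀ k, p k = s k E} ∧
    Convex ℝ {p : ι → ℝ | ∃ E, MeasurableSet E ∧ ∀ k, p k = s k E} := by
  have := Fintype.ofFinite ι
  have hs' (k) : VectorMeasure.restrict 0 Set.univ ≤ (s k).restrict Set.univ :=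
    VectorMeasure.restrict_le_restrict_of_subset_le _ _ fun E hE _ ↦ hs k E hE
  let m (k) : Measure X := (s k).toMeasureOfZeroLE Set.univ .univ (hs' k)
  have hm (k) {E : Set X} (hE : MeasurableSet E) : (m k).real E = s k E := by
    rw [SignedMeasure.toMeasureOfZeroLE_real_apply _ _ _ hE, Set.univ_inter]
  have hmfin (k) : IsFiniteMeasure (m k) := inferInstanceAs (IsFiniteMeasure ((s k).toMeasureOfZeroLE _ _ _))
  have hμ0 {E : Set X} (hE : MeasurableSet E) : (∑ k, m k) E ≠ 0 ↔ ∃ k, s k E ≠ 0 := by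
    simp only [Measure.finsetSum_apply, ne_eq, Finset.sum_eq_zero_iff, Finset.mem_univ,
      true_imp_iff, not_forall, ← hm _ hE, measureReal_eq_zero_iff (measure_ne_top (m _) E)]
  have h := isClosed_convex_range_of_le_nonatomic (μ := ∑ k, m k) (fun E hE hE0 ↦ by
    obtain ⟨F, hFE, hF, h1, h2⟩ := hna E hE ((hμ0 hE).1 hE0)
    exact ⟨F, hFE, hF, (hμ0 hF).2 h1, (hμ0 (hE.diff hF)).2 h2⟩) m fun k ↦
      Measure.le_iff.2 fun E hE ↦ by
        rw [Measure.finsetSum_apply]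
        exact Finset.single_le_sum (f := fun k ↦ m k E) (fun _ _ ↦ zero_le) (Finset.mem_univ k)
  have hset : {p : ι → ℝ | ∃ E, MeasurableSet E ∧ ∀ k, p k = s k E} =
      {p : ι → ℝ | ∃ E, MeasurableSet E ∧ ∀ k, p k = (m k).real E} := by
    ext p
    exact exists_congr fun E ↦ and_congr_right fun hE ↦ forall_congr' fun k ↦ by rw [hm k hE]
  rwa [hset]

/-- Finitely many quadratic evaluations `T ↦ ⟪T x, x⟫` determine an operator. -/
theorem exists_finite_inner_map_separating (H : Type*) [NormedAddCommGroup H]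
    [InnerProductSpace ℂ H] [FiniteDimensional ℂ H] :
    ∃ Q : Set H, Q.Finite ∧ ∀ T : H →L[ℂ] H, (∀ x ∈ Q, ⟪T x, x⟫ = 0) → T = 0 := by
  let b := stdOrthonormalBasis ℂ H
  let Q (c : ℂ) : Set H := Set.range fun i : Fin _ × Fin _ ↦ b i.1 + c • b i.2
  refine ⟨Q 1 ∪ Q (-1) ∪ Q Complex.I ∪ Q (-Complex.I),
    (((Set.finite_range _).union (Set.finite_range _)).union (Set.finite_range _)).union
      (Set.finite_range _), fun T hT ↦ ?_⟩
  have h (i j) : ⟪T (b j), b i⟫ = 0 := by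
    have h1 := hT (b i + (1 : ℂ) • b j) (.inl (.inl (.inl ⟨(i, j), rfl⟩)))
    have h2 := hT (b i + (-1 : ℂ) • b j) (.inl (.inl (.inr ⟨(i, j), rfl⟩)))
    have h3 := hT (b i + Complex.I • b j) (.inl (.inr ⟨(i, j), rfl⟩))
    have h4 := hT (b i + (-Complex.I) • b j) (.inr ⟨(i, j), rfl⟩)
    rw [one_smul] at h1
    rw [neg_smul, one_smul, ← sub_eq_add_neg] at h2
    rw [neg_smul, ← sub_eq_add_neg] at h4
    have := inner_map_polarization T.toLinearMap (b i) (b j)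
    simpa only [ContinuousLinearMap.coe_coe, h1, h2, h3, h4, mul_zero, sub_zero, add_zero,
      zero_div] using this
  ext x
  rw [← b.sum_repr x]
  simp only [map_sum, map_smul]
  refine (Finset.sum_eq_zero fun j _ ↦ ?_).trans (by simp)
  rw [← b.sum_repr' (T (b j)), Finset.sum_eq_zero, smul_zero]
  exact fun i _ ↦ by rw [← inner_conj_symm, h i j, map_zero, zero_smul]

/-- **Operator-valued Lyapunov theorem for tuples (finite dimensions).** If
`ν 1, …, ν n` are nonatomic positive operator-valued measures with values in the
bounded operators on finite-dimensional complex Hilbert spaces `H 1, …, H n`, then the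
set of points `(ν 1 E, …, ν n E)`, with `E` ranging over the measurable sets, is a
closed convex subset of the product space. -/
theorem povm_tuple_range_closed_convex
    {X : Type*} [MeasurableSpace X] {n : ℕ}
    {H : Fin n → Type*} [∀ i, NormedAddCommGroup (H i)]
    [∀ i, InnerProductSpace ℂ (H i)] [∀ i, FiniteDimensional ℂ (H i)]
    (ν : ∀ i, VectorMeasure X (H i →L[ℂ] H i))
    (hpos : ∀ i, ∀ E : Set X, MeasurableSet E → ∀ x : H i, 0 ≤ ⟪(ν i E) x, x⟫)
    (hnonatomic : ∀ i, ∀ E : Set X, MeasurableSet E → ν i E ≠ 0 →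
      ∃ F ⊆ E, MeasurableSet F ∧ ν i F ≠ 0 ∧ ν i F ≠ ν i E) :
    IsClosed {p : ∀ i, H i →L[ℂ] H i | ∃ E : Set X, MeasurableSet E ∧
        ∀ i, p i = ν i E} ∧
    Convex ℝ {p : ∀ i, H i →L[ℂ] H i | ∃ E : Set X, MeasurableSet E ∧
        ∀ i, p i = ν i E} := by
  choose Q hQ hQsep using fun i ↦ exists_finite_inner_map_separating (H i)
  have hfin (i) : Finite (Q i) := hQ i
  let ι := Σ i, Q i
  let ℓ (k : ι) : (∀ i, H i →L[ℂ] H i) → ℂ := fun p ↦ ⟪p k.1 k.2, k.2⟫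
  have hℓ (k : ι) : Continuous (ℓ k) := by fun_prop
  let s (k : ι) : SignedMeasure X := (ν k.1).mapRange
    { toFun := fun T ↦ (⟪T k.2, (k.2 : H k.1)⟫).re
      map_zero' := by simp
      map_add' := fun S T ↦ by simp }
    (by simp only [AddMonoidHom.coe_mk, ZeroHom.coe_mk]; fun_prop)
  have hsν (k : ι) (E : Set X) : s k E = (ℓ k fun i ↦ ν i E).re := rfl
  have hreal (k : ι) {E : Set X} (hE : MeasurableSet E) : (ℓ k fun i ↦ ν i E).im = 0 :=
    (Complex.nonneg_iff.1 (hpos k.1 E hE k.2)).2.symm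
  have hs (k : ι) (E : Set X) (hE : MeasurableSet E) : 0 ≤ s k E :=
    (Complex.nonneg_iff.1 (hpos k.1 E hE k.2)).1
  have hs0 {E : Set X} (hE : MeasurableSet E) (i) (h : ν i E ≠ 0) : ∃ k, s k E ≠ 0 := by
    by_contra! H
    exact h (hQsep i _ fun x hx ↦ Complex.ext (H ⟨i, x, hx⟩) (hreal ⟨i, x, hx⟩ hE))
  obtain ⟨hclosed, hconvex⟩ := SignedMeasure.isClosed_convex_range_of_nonatomic s hs
    fun E hE ⟨k, hk⟩ ↦ by
      obtain ⟨F, hFE, hF, hF0, hFE'⟩ := hnonatomic k.1 E hE fun h ↦ hk (by simp [hsν, ℓ, h])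
      refine ⟨F, hFE, hF, hs0 hF k.1 hF0, hs0 (hE.diff hF) k.1 fun h ↦ hFE' ?_⟩
      rw [← VectorMeasure.of_add_of_sdiff hF hE hFE, h, add_zero]
  let L : (∀ i, H i →L[ℂ] H i) →ₗ[ℝ] ι → ℝ :=
    { toFun := fun p k ↦ (ℓ k p).re
      map_add' := fun p q ↦ funext fun k ↦ by simp [ℓ]
      map_smul' := fun c p ↦ funext fun k ↦ by simp [ℓ, inner_smul_left_eq_smul] }
  let M : (∀ i, H i →L[ℂ] H i) →ₗ[ℝ] ι → ℝ :=
    { toFun := fun p k ↦ (ℓ k p).im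
      map_add' := fun p q ↦ funext fun k ↦ by simp [ℓ]
      map_smul' := fun c p ↦ funext fun k ↦ by simp [ℓ, inner_smul_left_eq_smul] }
  have hL : Continuous L := continuous_pi fun k ↦ Complex.continuous_re.comp (hℓ k)
  have hM : Continuous M := continuous_pi fun k ↦ Complex.continuous_im.comp (hℓ k)
  have hrange : {p : ∀ i, H i →L[ℂ] H i | ∃ E : Set X, MeasurableSet E ∧ ∀ i, p i = ν i E} =
      L ⁻¹' {p : ι → ℝ | ∃ E, MeasurableSet E ∧ ∀ k, p k = s k E} ∩ M ⁻¹' {0} := by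
    ext p
    constructor
    · rintro ⟨E, hE, hp⟩
      obtain rfl : p = fun i ↦ ν i E := funext hp
      exact ⟨⟨E, hE, fun _ ↦ rfl⟩, funext fun k ↦ hreal k hE⟩
    · rintro ⟨⟨E, hE, hp⟩, hp'⟩
      refine ⟨E, hE, fun i ↦ sub_eq_zero.1 (hQsep i _ fun x hx ↦ ?_)⟩
      rw [sub_apply, inner_sub_left, sub_eq_zero]
      exact Complex.ext (hp ⟨i, x, hx⟩)
        ((congrFun hp' ⟨i, x, hx⟩).trans (hreal ⟨i, x, hx⟩ hE).symm)
  rw [hrange]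
  exact ⟨(hclosed.preimage hL).inter (isClosed_singleton.preimage hM),
    (hconvex.linear_preimage L).inter ((convex_singleton 0).linear_preimage M)⟩
end

section
/- Let X be a measurable space and let (μₙ)_{n ∈ ℕ} be a sequence of nonatomic probability measures on X which are pairwise mutually singular. Then for every sequence (λₙ)_{n ∈ ℕ} with 0 ≤ λₙ ≤ 1 for all n there exists a single measurable set E ⊆ X such that μₙ(E) = λₙ for every n; consequently, the set {(μ₁(E), μ₂(E), …) : E measurable} of sequences of measure values equals the full product {(λₙ) : 0 ≤ λₙ ≤ 1 for all n}. -/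
open MeasureTheory Filter Topology

section Nonatomic

variable {X : Type*} [MeasurableSpace X] {μ : Measure X}

/-- Among the measurable supersets of `E` of measure at most `c`, some `E'` realizes at least half
of the possible increase in measure. -/
lemma exists_superset_add_le_two_mul {c : ℝ} {E : Set X} (hE : MeasurableSet E)
    (hEc : μ.real E ≤ c) :
    ∃ E', MeasurableSet E' ∧ μ.real E' ≤ c ∧ E ⊆ E' ∧
      ∀ G, MeasurableSet G → E ⊆ G → μ.real G ≤ c → μ.real G + μ.real E ≤ 2 * μ.real E' := by
  by_contra! h
  let V : Set ℝ := {r | ∃ G, MeasurableSet G ∧ E ⊆ G ∧ μ.real G ≤ c ∧ μ.real G = r}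
  have hbdd : BddAbove V := ⟨c, by rintro _ ⟨G, -, -, hG, rfl⟩; exact hG⟩
  have hne : V.Nonempty := ⟨_, E, hE, subset_rfl, hEc, rfl⟩
  obtain ⟨G, hG, hEG, hGc, hlt⟩ := h E hE hEc subset_rfl
  have hGV : μ.real G ≤ sSup V := le_csSup hbdd ⟨G, hG, hEG, hGc, rfl⟩
  obtain ⟨_, ⟨H, hH, hEH, hHc, rfl⟩, hHlt⟩ :=
    exists_lt_of_lt_csSup hne (show (sSup V + μ.real E) / 2 < sSup V by linarith)
  obtain ⟨K, hK, hEK, hKc, hKlt⟩ := h H hH hHc hEH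
  have hKV : μ.real K ≤ sSup V := le_csSup hbdd ⟨K, hK, hEK, hKc, rfl⟩
  linarith

variable [IsFiniteMeasure μ]

/-- In a finite nonatomic measure space, every set of positive measure has a subset of positive
measure which is at most `2⁻ᵏ` times as large. -/
lemma exists_subset_measureReal_le_div_two_pow
    (hμ : ∀ E : Set X, MeasurableSet E → μ E ≠ 0 →
      ∃ F ⊆ E, MeasurableSet F ∧ μ F ≠ 0 ∧ μ F ≠ μ E)
    {E : Set X} (hE : MeasurableSet E) (hE0 : 0 < μ.real E) (k : ℕ) :
    ∃ F ⊆ E, MeasurableSet F ∧ 0 < μ.real F ∧ μ.real F ≤ μ.real E / 2 ^ k := by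
  induction k with
  | zero => exact ⟨E, subset_rfl, hE, hE0, by simp⟩
  | succ k ih =>
    obtain ⟨F, hFE, hF, hF0, hFle⟩ := ih
    obtain ⟨G, hGF, hG, hG0, hGne⟩ := hμ F hF (fun h ↦ by simp [measureReal_def, h] at hF0)
    have hdiff : μ.real (F \ G) = μ.real F - μ.real G := measureReal_sdiff hGF hG
    have hGpos : 0 < μ.real G := ENNReal.toReal_pos hG0 (measure_ne_top _ _)
    have hGle : μ.real G ≤ μ.real F := measureReal_mono hGF
    have hGlt : μ.real G < μ.real F := lt_of_le_of_ne hGle fun h ↦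
      hGne ((ENNReal.toReal_eq_toReal_iff' (measure_ne_top _ _) (measure_ne_top _ _)).1 h)
    have hpow : μ.real E / 2 ^ (k + 1) = μ.real E / 2 ^ k / 2 := by rw [pow_succ, div_div]
    rcases le_total (μ.real G) (μ.real F / 2) with h | h
    · exact ⟨G, hGF.trans hFE, hG, hGpos, by linarith⟩
    · exact ⟨F \ G, Set.sdiff_subset.trans hFE, hF.diff hG, by linarith, by linarith⟩

/-- In a finite nonatomic measure space, sets of positive measure have subsets of arbitrarily small
positive measure. -/
lemma exists_subset_measureReal_lt
    (hμ : ∀ E : Set X, MeasurableSet E → μ E ≠ 0 →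
      ∃ F ⊆ E, MeasurableSet F ∧ μ F ≠ 0 ∧ μ F ≠ μ E)
    {E : Set X} (hE : MeasurableSet E) (hE0 : 0 < μ.real E) {ε : ℝ} (hε : 0 < ε) :
    ∃ F ⊆ E, MeasurableSet F ∧ 0 < μ.real F ∧ μ.real F < ε := by
  obtain ⟨k, hk⟩ := pow_unbounded_of_one_lt (μ.real E / ε) (one_lt_two : (1 : ℝ) < 2)
  obtain ⟨F, hFE, hF, hF0, hFle⟩ := exists_subset_measureReal_le_div_two_pow hμ hE hE0 k
  refine ⟨F, hFE, hF, hF0, hFle.trans_lt ?_⟩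
  rw [div_lt_iff₀ hε] at hk
  rw [div_lt_iff₀ (by positivity)]
  linarith

/-- There is a measurable set of measure at most `c` none of whose measurable supersets of measure
at most `c` has larger measure. -/
lemma exists_maximal_measureReal_le (μ : Measure X) [IsFiniteMeasure μ] {c : ℝ} (hc : 0 ≤ c) :
    ∃ E, MeasurableSet E ∧ μ.real E ≤ c ∧
      ∀ G, MeasurableSet G → E ⊆ G → μ.real G ≤ c → μ.real G ≤ μ.real E := by
  let T := {E : Set X // MeasurableSet E ∧ μ.real E ≤ c}
  have hstep : ∀ E : T, ∃ E' : T, E.1 ⊆ E'.1 ∧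
      ∀ G, MeasurableSet G → E.1 ⊆ G → μ.real G ≤ c →
        μ.real G + μ.real E.1 ≤ 2 * μ.real E'.1 := fun E ↦ by
    obtain ⟨E', h, h', h''⟩ := exists_superset_add_le_two_mul E.2.1 E.2.2
    exact ⟨⟨E', h, h'⟩, h''⟩
  choose next hsub hnext using hstep
  let A : ℕ → T := fun n ↦ next^[n] ⟨∅, MeasurableSet.empty, by simpa using hc⟩
  have hA (n : ℕ) : A (n + 1) = next (A n) := Function.iterate_succ_apply' _ _ _
  have hmono : Monotone fun n ↦ (A n).1 := monotone_nat_of_le_succ fun n ↦ by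
    rw [hA]; exact hsub _
  have hlim : Tendsto (fun n ↦ μ.real (A n).1) atTop (𝓝 (μ.real (⋃ n, (A n).1))) :=
    (ENNReal.tendsto_toReal (measure_ne_top _ _)).comp (tendsto_measure_iUnion_atTop hmono)
  refine ⟨⋃ n, (A n).1, MeasurableSet.iUnion fun n ↦ (A n).2.1,
    le_of_tendsto' hlim fun n ↦ (A n).2.2, fun G hG hAG hGc ↦ ?_⟩
  have hle := le_of_tendsto_of_tendsto' (hlim.const_add (μ.real G))
    ((hlim.comp (tendsto_add_atTop_nat 1)).const_mul 2) fun n ↦ by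
      simpa only [Function.comp_apply, hA] using
        hnext (A n) G hG ((Set.subset_iUnion (fun n ↦ (A n).1) n).trans hAG) hGc
  linarith

/-- **Sierpiński's theorem**: a finite nonatomic measure takes every value between `0` and its
total mass. -/
lemma exists_measurableSet_measureReal_eq
    (hμ : ∀ E : Set X, MeasurableSet E → μ E ≠ 0 →
      ∃ F ⊆ E, MeasurableSet F ∧ μ F ≠ 0 ∧ μ F ≠ μ E)
    {c : ℝ} (hc : 0 ≤ c) (hc' : c ≤ μ.real Set.univ) :
    ∃ E, MeasurableSet E ∧ μ.real E = c := by
  obtain ⟨E, hE, hEc, hmax⟩ := exists_maximal_measureReal_le μ hc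
  refine ⟨E, hE, hEc.antisymm (not_lt.1 fun hlt ↦ ?_)⟩
  have hcompl : 0 < μ.real Eᶜ := by rw [measureReal_compl hE]; linarith
  obtain ⟨F, hFE, hF, hF0, hFlt⟩ := exists_subset_measureReal_lt hμ hE.compl hcompl (sub_pos.2 hlt)
  have hunion : μ.real (E ∪ F) = μ.real E + μ.real F :=
    measureReal_union (Set.subset_compl_iff_disjoint_left.1 hFE) hF
  have := hmax (E ∪ F) (hE.union hF) Set.subset_union_left (by linarith)
  linarith

end Nonatomic

/-- Countably many pairwise mutually singular measures are carried by measurable sets, each of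
which is null for all the other measures. -/
lemma exists_carriers_of_pairwise_mutuallySingular {X ι : Type*} [MeasurableSpace X] [Countable ι]
    {μ : ι → Measure X} (hμ : ∀ m n, m ≠ n → (μ m).MutuallySingular (μ n)) :
    ∃ S : ι → Set X, (∀ n, MeasurableSet (S n)) ∧ (∀ n, μ n (S n)ᶜ = 0) ∧
      ∀ m n, m ≠ n → μ m (S n) = 0 := by
  refine ⟨fun n ↦ ⋂ (m) (h : m ≠ n), (hμ m n h).nullSet, fun n ↦ ?_, fun n ↦ ?_, fun m n h ↦ ?_⟩
  · exact MeasurableSet.iInter fun m ↦ MeasurableSet.iInter fun h ↦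
      (hμ m n h).measurableSet_nullSet
  · simp only [Set.compl_iInter, measure_iUnion_null_iff]
    exact fun m h ↦ (hμ m n h).measure_compl_nullSet
  · exact measure_mono_null (Set.iInter₂_subset m h) (hμ m n h).measure_nullSet

/-- For a sequence of pairwise mutually singular nonatomic probability measures `μₙ`,
every sequence `(λₙ)` in `[0,1]` is realized as `(μₙ E)ₙ` for a single measurable set `E`;
consequently the set of achievable sequences of measure values is the full product of
copies of `[0,1]`. -/
theorem mutuallySingular_nonatomic_range_eq_pi
    {X : Type*} [MeasurableSpace X] (μ : ℕ → Measure X)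
    (hprob : ∀ n, IsProbabilityMeasure (μ n))
    (hnonatomic : ∀ n, ∀ E : Set X, MeasurableSet E → μ n E ≠ 0 →
      ∃ F ⊆ E, MeasurableSet F ∧ μ n F ≠ 0 ∧ μ n F ≠ μ n E)
    (hsing : ∀ m n, m ≠ n → (μ m).MutuallySingular (μ n)) :
    (∀ l : ℕ → ℝ, (∀ n, 0 ≤ l n ∧ l n ≤ 1) →
      ∃ E : Set X, MeasurableSet E ∧ ∀ n, (μ n E).toReal = l n) ∧
    {p : ℕ → ℝ | ∃ E : Set X, MeasurableSet E ∧ ∀ n, p n = (μ n E).toReal} =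
      {p : ℕ → ℝ | ∀ n, 0 ≤ p n ∧ p n ≤ 1} := by
  have hmain : ∀ l : ℕ → ℝ, (∀ n, 0 ≤ l n ∧ l n ≤ 1) →
      ∃ E : Set X, MeasurableSet E ∧ ∀ n, (μ n E).toReal = l n := by
    intro l hl
    obtain ⟨S, hS, hScompl, hSnull⟩ := exists_carriers_of_pairwise_mutuallySingular hsing
    choose F hF hFl using fun n ↦ exists_measurableSet_measureReal_eq (hnonatomic n)
      (hl n).1 (by simpa using (hl n).2)
    refine ⟨⋃ n, F n ∩ S n, MeasurableSet.iUnion fun n ↦ (hF n).inter (hS n), fun n ↦ ?_⟩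
    rw [← hFl n, measureReal_def]
    congr 1
    refine measure_congr ?_
    have hcarrier : ∀ᵐ x ∂μ n, x ∈ S n := hScompl n
    have hother : ∀ᵐ x ∂μ n, ∀ m, n ≠ m → x ∉ S m :=
      ae_all_iff.2 fun m ↦ eventually_imp_distrib_left.2 fun h ↦ measure_eq_zero_iff_ae_notMem.1 (hSnull n m h)
    filter_upwards [hcarrier, hother] with x hx hx'
    refine propext (Set.mem_iUnion.trans ⟨?_, fun h ↦ ⟨n, h, hx⟩⟩)
    rintro ⟨m, hFm, hSm⟩
    obtain rfl : n = m := by_contra fun h ↦ hx' m h hSm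
    exact hFm
  refine ⟨hmain, Set.ext fun p ↦ ⟨?_, fun hp ↦ ?_⟩⟩
  · rintro ⟨E, -, hp⟩ n
    rw [hp n]
    exact ⟨ENNReal.toReal_nonneg, measureReal_le_one⟩
  · obtain ⟨E, hE, h⟩ := hmain p hp
    exact ⟨E, hE, fun n ↦ (h n).symm⟩
end

section
/- Let X be a measurable space, let H be a finite-dimensional complex inner product space, let ν be a nonatomic positive operator-valued measure on X with values in B(H), and let E be a measurable set with ν(E) ≠ 0. Then integration against ν is classically non-injective on E in the following sense: there exist m ∈ ℕ, pairwise disjoint measurable sets F₁, …, F_m ⊆ E with ν(Fᵢ) ≠ 0 for every i, and real coefficients c₁, …, c_m, not all zero, such that c₁·ν(F₁) + ⋯ + c_m·ν(F_m) = 0 in B(H). -/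
open MeasureTheory
open scoped ComplexInnerProductSpace ComplexOrder

/-- Below a set of nonzero measure, a nonatomic vector measure has arbitrarily large finite
families of pairwise disjoint measurable sets of nonzero measure. -/
theorem MeasureTheory.VectorMeasure.exists_pairwise_disjoint_ne_zero
    {X : Type*} [MeasurableSpace X] {M : Type*} [AddCommGroup M] [TopologicalSpace M] [T2Space M]
    (ν : VectorMeasure X M)
    (hnonatomic : ∀ E : Set X, MeasurableSet E → ν E ≠ 0 →
      ∃ F ⊆ E, MeasurableSet F ∧ ν F ≠ 0 ∧ ν F ≠ ν E)
    (n : ℕ) (E : Set X) (hE : MeasurableSet E) (hEne : ν E ≠ 0) :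
    ∃ F : Fin (n + 1) → Set X, Pairwise (Function.onFun Disjoint F) ∧
      ∀ i, MeasurableSet (F i) ∧ F i ⊆ E ∧ ν (F i) ≠ 0 := by
  induction n generalizing E with
  | zero => exact ⟨fun _ => E, fun i j hij => (hij (Subsingleton.elim (α := Fin 1) i j)).elim,
      fun _ => ⟨hE, subset_rfl, hEne⟩⟩
  | succ n ih =>
    obtain ⟨G, hGE, hG, hGne, hGneE⟩ := hnonatomic E hE hEne
    have hdiff : ν (E \ G) ≠ 0 := fun h => hGneE <| by
      simpa [h] using VectorMeasure.of_add_of_sdiff (v := ν) hG hE hGE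
    obtain ⟨F, hFdisj, hF⟩ := ih (E \ G) (hE.diff hG) hdiff
    have hGF : ∀ i, Disjoint G (F i) := fun i => Set.disjoint_sdiff_right.mono_right (hF i).2.1
    refine ⟨Fin.cons G F, fun i j hij => ?_, fun i => ?_⟩
    · cases i using Fin.cases with
      | zero =>
        cases j using Fin.cases with
        | zero => exact (hij rfl).elim
        | succ j => simpa [Function.onFun] using hGF j
      | succ i =>
        cases j using Fin.cases with
        | zero => simpa [Function.onFun] using (hGF i).symm
        | succ j =>
          simpa [Function.onFun] using hFdisj fun h : i = j => hij (congrArg Fin.succ h)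
    · cases i using Fin.cases with
      | zero => exact ⟨hG, hGE, hGne⟩
      | succ i => exact ⟨(hF i).1, (hF i).2.1.trans Set.sdiff_subset, (hF i).2.2⟩

/-- For a nonatomic positive operator-valued measure `ν` into the bounded operators on a
finite-dimensional complex Hilbert space and a measurable set `E` with `ν E ≠ 0`,
integration against `ν` is classically non-injective on `E`: there are finitely many
pairwise disjoint measurable subsets `F i ⊆ E` of nonzero measure and real coefficients
`c i`, not all zero, with `∑ i, c i • ν (F i) = 0`. -/
theorem povm_classically_non_injective
    {X : Type*} [MeasurableSpace X]
    {H : Type*} [NormedAddCommGroup H] [InnerProductSpace ℂ H]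
    [FiniteDimensional ℂ H]
    (ν : VectorMeasure X (H →L[ℂ] H))
    (hpos : ∀ E : Set X, MeasurableSet E → ∀ x : H, 0 ≤ ⟪(ν E) x, x⟫)
    (hnonatomic : ∀ E : Set X, MeasurableSet E → ν E ≠ 0 →
      ∃ F ⊆ E, MeasurableSet F ∧ ν F ≠ 0 ∧ ν F ≠ ν E)
    (E : Set X) (hE : MeasurableSet E) (hEne : ν E ≠ 0) :
    ∃ (m : ℕ) (F : Fin m → Set X) (c : Fin m → ℝ),
      Pairwise (Function.onFun Disjoint F) ∧
      (∀ i, MeasurableSet (F i)) ∧ (∀ i, F i ⊆ E) ∧ (∀ i, ν (F i) ≠ 0) ∧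
      c ≠ 0 ∧ ∑ i, c i • ν (F i) = 0 := by
  have : FiniteDimensional ℝ (H →L[ℂ] H) := Module.Finite.trans ℂ _
  obtain ⟨F, hFdisj, hF⟩ := ν.exists_pairwise_disjoint_ne_zero hnonatomic
    (Module.finrank ℝ (H →L[ℂ] H)) E hE hEne
  have hdep : ¬ LinearIndependent ℝ fun i => ν (F i) := fun h => by
    simpa using h.fintype_card_le_finrank
  obtain ⟨c, hc, i, hi⟩ := Fintype.not_linearIndependent_iff.mp hdep
  exact ⟨_, F, c, hFdisj, fun i => (hF i).1, fun i => (hF i).2.1, fun i => (hF i).2.2,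
    fun h => hi (congrFun h i), hc⟩
end

section
/- Let X be a measurable space, let H be a complex Hilbert space, let ν be a nonatomic positive operator-valued measure on X with values in B(H), and let E be a measurable set with ν(E) ≠ 0. Then there exists a sequence (Fₙ)_{n ∈ ℕ} of pairwise disjoint measurable subsets of E with ν(Fₙ) ≠ 0 for every n. -/
open MeasureTheory
open scoped ComplexInnerProductSpace ComplexOrder

/-- If every measurable set of nonzero measure can be split by a measurable subset whose measure
is neither zero nor that of the whole set, then every such set contains a sequence of pairwise
disjoint measurable subsets of nonzero measure. -/
theorem MeasureTheory.VectorMeasure.exists_disjoint_seq_of_nonatomic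
    {X : Type*} [MeasurableSpace X]
    {M : Type*} [AddCommGroup M] [TopologicalSpace M] [T2Space M] (ν : VectorMeasure X M)
    (hnonatomic : ∀ E : Set X, MeasurableSet E → ν E ≠ 0 →
      ∃ F ⊆ E, MeasurableSet F ∧ ν F ≠ 0 ∧ ν F ≠ ν E)
    {E : Set X} (hE : MeasurableSet E) (hEne : ν E ≠ 0) :
    ∃ F : ℕ → Set X, Pairwise (Function.onFun Disjoint F) ∧
      (∀ n, MeasurableSet (F n)) ∧ (∀ n, F n ⊆ E) ∧ (∀ n, ν (F n) ≠ 0) := by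
  choose split split_sub split_meas split_ne split_ne_whole using hnonatomic
  let G : ℕ → {A : Set X // MeasurableSet A ∧ ν A ≠ 0} := fun n =>
    Nat.rec ⟨E, hE, hEne⟩
      (fun _ A => ⟨split A A.2.1 A.2.2, split_meas A A.2.1 A.2.2, split_ne A A.2.1 A.2.2⟩) n
  have hsucc (n : ℕ) : (G (n + 1)).1 ⊆ (G n).1 := split_sub _ (G n).2.1 (G n).2.2
  have hanti : Antitone fun n => (G n).1 := antitone_nat_of_succ_le hsucc
  refine ⟨fun n => (G n).1 \ (G (n + 1)).1, ?_, fun n => (G n).2.1.diff (G (n + 1)).2.1,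
    fun n => Set.sdiff_subset.trans (hanti n.zero_le), fun n hn => ?_⟩
  · rw [pairwise_disjoint_on]
    intro m n hmn
    exact Set.disjoint_sdiff_left.mono_right (Set.sdiff_subset.trans (hanti hmn))
  · have hadd := VectorMeasure.of_add_of_sdiff (v := ν) (G (n + 1)).2.1 (G n).2.1 (hsucc n)
    rw [hn, add_zero] at hadd
    exact split_ne_whole _ (G n).2.1 (G n).2.2 hadd

/-- For a nonatomic positive operator-valued measure `ν` on `X` with values in the bounded
operators on a complex Hilbert space and a measurable set `E` with `ν E ≠ 0`, there is a
sequence of pairwise disjoint measurable subsets of `E`, each of nonzero measure. -/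
theorem povm_nonatomic_exists_disjoint_seq
    {X : Type*} [MeasurableSpace X]
    {H : Type*} [NormedAddCommGroup H] [InnerProductSpace ℂ H]
    (ν : VectorMeasure X (H →L[ℂ] H))
    (hpos : ∀ E : Set X, MeasurableSet E → ∀ x : H, 0 ≤ ⟪(ν E) x, x⟫)
    (hnonatomic : ∀ E : Set X, MeasurableSet E → ν E ≠ 0 →
      ∃ F ⊆ E, MeasurableSet F ∧ ν F ≠ 0 ∧ ν F ≠ ν E)
    (E : Set X) (hE : MeasurableSet E) (hEne : ν E ≠ 0) :
    ∃ F : ℕ → Set X, Pairwise (Function.onFun Disjoint F) ∧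
      (∀ n, MeasurableSet (F n)) ∧ (∀ n, F n ⊆ E) ∧ (∀ n, ν (F n) ≠ 0) := by
  exact ν.exists_disjoint_seq_of_nonatomic hnonatomic hE hEne
end
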